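/- arXiv:1901.10542 — 4 statements merged into one kernel-verified Lean document; each statement's English description precedes it below -/
import Mathlib

section
/- Let E be a complex Banach space, A ∈ E, r > 0 and M ≥ 0. Let f : E → ℂ be a function such that: (i) |f(x)| ≤ M for every x in the open ball B(A, r); (ii) f is finitely (Gâteaux) holomorphic on B(A, r), i.e. for every x ∈ B(A, r) and every h ∈ E the map z ↦ f(x + z·h) from ℂ to ℂ is analytic at z = 0. Then f is analytic at every point of B(A, r); in particular f is analytic at A and equals the sum of a convergent series of continuous homogeneous polynomials near A. -/
open Metric

open Filter Function Set
open scoped Topology Nat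

section OneVariable

variable {F : Type*} [NormedAddCommGroup F] [NormedSpace ℂ F]

theorem norm_deriv_le_of_norm_le_on_ball {g : ℂ → F} {R M : ℝ} (hR : 0 < R)
    (hd : DifferentiableOn ℂ g (ball 0 R)) (hM : ∀ w ∈ ball (0 : ℂ) R, ‖g w‖ ≤ M) :
    ‖deriv g 0‖ ≤ 2 * M / R := by
  refine Complex.norm_deriv_le_div_of_mapsTo_ball hd (fun w hw => ?_) hR
  rw [mem_closedBall, dist_eq_norm]
  linarith [norm_sub_le (g w) (g 0), hM w hw, hM 0 (mem_ball_self hR)]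

/-- Quadratic estimate for the first order Taylor remainder of a bounded holomorphic function. -/
theorem norm_sub_sub_smul_deriv_le {g : ℂ → F} {R M : ℝ} (hR : 0 < R)
    (hd : DifferentiableOn ℂ g (ball 0 R)) (hM : ∀ w ∈ ball (0 : ℂ) R, ‖g w‖ ≤ M)
    {w : ℂ} (hw : w ∈ ball (0 : ℂ) R) :
    ‖g w - g 0 - w • deriv g 0‖ ≤ 4 * M / R ^ 2 * ‖w‖ ^ 2 := by
  have hderiv := norm_deriv_le_of_norm_le_on_ball hR hd hM
  set k : ℂ → F := fun w => g w - g 0 - w • deriv g 0 with hk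
  have hk0 : k 0 = 0 := by simp [hk]
  have hg : HasDerivAt g (deriv g 0) 0 :=
    (hd.differentiableAt (ball_mem_nhds _ hR)).hasDerivAt
  have hdk : DifferentiableOn ℂ k (ball 0 R) := by
    refine (hd.sub_const _).sub ?_
    fun_prop
  have hmaps : MapsTo k (ball 0 R) (closedBall (k 0) (4 * M)) := by
    intro v hv
    have hv' : ‖v‖ ≤ R := by simpa using (mem_ball.1 hv).le
    have h1 : ‖v • deriv g 0‖ ≤ 2 * M := by
      rw [norm_smul]
      calc ‖v‖ * ‖deriv g 0‖ ≤ R * (2 * M / R) := by gcongr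
        _ = 2 * M := by field_simp
    rw [hk0, mem_closedBall, dist_zero_right]
    linarith [norm_sub_le (g v - g 0) (v • deriv g 0), norm_sub_le (g v) (g 0), hM v hv,
      hM 0 (mem_ball_self hR)]
  have hlittle : (k · - k 0) =o[𝓝 0] (fun w => ‖w - 0‖ ^ 1) := by
    have := hasDerivAt_iff_isLittleO.1 hg
    simpa [hk] using this.norm_right
  have := Complex.dist_le_mul_div_pow_of_mapsTo_ball_of_isLittleO hdk hmaps hlittle hw
  rw [hk0, dist_zero_right, dist_zero_right] at this
  refine this.trans_eq ?_
  ring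

end OneVariable

section GateauxHolomorphic

variable {E F : Type*} [NormedAddCommGroup E] [NormedSpace ℂ E]
  [NormedAddCommGroup F] [NormedSpace ℂ F]

/-- A function is locally bounded and Gâteaux holomorphic on a set `U` if it is complex
differentiable along every line at every point of `U` and bounded near every point of `U`. -/
structure GateauxHolomorphicOn (f : E → F) (U : Set E) : Prop where
  lineDifferentiableAt : ∀ x ∈ U, ∀ h, LineDifferentiableAt ℂ f x h
  locallyBounded : ∀ x ∈ U, ∃ C, ∀ᶠ y in 𝓝 x, ‖f y‖ ≤ C

theorem HasLineDerivAt.hasDerivAt_line {f : E → F} {f' : F} {x h : E} {z : ℂ}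
    (hf : HasLineDerivAt ℂ f f' (x + z • h) h) :
    HasDerivAt (fun w : ℂ => f (x + w • h)) f' z := by
  have hf' : HasDerivAt (fun w : ℂ => f (x + z • h + w • h)) f' (z - z) := by
    simpa [HasLineDerivAt] using hf
  have := hf'.comp_sub_const z z
  refine this.congr_of_eventuallyEq (Eventually.of_forall fun w => ?_)
  simp only [add_assoc, ← add_smul]
  simp

namespace GateauxHolomorphicOn

variable {f : E → F} {U : Set E}

theorem hasDerivAt_line (hf : GateauxHolomorphicOn f U) {x h : E} {z : ℂ}
    (hz : x + z • h ∈ U) :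
    HasDerivAt (fun w : ℂ => f (x + w • h)) (lineDeriv ℂ f (x + z • h) h) z :=
  (hf.lineDifferentiableAt _ hz h).hasLineDerivAt.hasDerivAt_line

theorem norm_lineDeriv_le (hf : GateauxHolomorphicOn f U) {x h : E} {δ M : ℝ} (hδ : 0 < δ)
    (hU : ball x δ ⊆ U) (hM : ∀ y ∈ ball x δ, ‖f y‖ ≤ M) :
    ‖lineDeriv ℂ f x h‖ ≤ 2 * M / δ * ‖h‖ := by
  rcases eq_or_ne h 0 with rfl | hh
  · simp [lineDeriv_zero]
  have hh' : 0 < ‖h‖ := norm_pos_iff.2 hh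
  have hmem : ∀ w ∈ ball (0 : ℂ) (δ / ‖h‖), x + w • h ∈ ball x δ := by
    intro w hw
    rw [mem_ball_zero_iff, lt_div_iff₀ hh'] at hw
    simpa [dist_eq_norm, norm_smul] using hw
  refine (norm_deriv_le_of_norm_le_on_ball (div_pos hδ hh')
    (fun w hw => (hf.hasDerivAt_line (hU (hmem w hw))).differentiableAt.differentiableWithinAt)
    (fun w hw => hM _ (hmem w hw))).trans_eq ?_
  field_simp

/-- The first order expansion along lines in a fixed direction is locally uniform. -/
theorem exists_norm_sub_sub_smul_lineDeriv_le (hf : GateauxHolomorphicOn f U) (hU : IsOpen U)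
    {x : E} (hx : x ∈ U) (h : E) :
    ∃ C : ℝ, ∃ ρ > 0, ∀ y ∈ ball x ρ, ∀ w ∈ ball (0 : ℂ) ρ, y + w • h ∈ U ∧
      ‖f (y + w • h) - f y - w • lineDeriv ℂ f y h‖ ≤ C * ‖w‖ ^ 2 := by
  obtain ⟨M, hM⟩ := hf.locallyBounded x hx
  obtain ⟨ε, hε, hball⟩ := Metric.mem_nhds_iff.1 (inter_mem (hU.mem_nhds hx) hM)
  have hpos : 0 < ‖h‖ + 1 := by positivity
  set ρ := ε / (‖h‖ + 1) / 2 with hρ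
  have hρε : ρ + ρ * ‖h‖ = ε / 2 := by rw [hρ]; field_simp; ring
  have hρ0 : 0 < ρ := by positivity
  refine ⟨4 * M / ρ ^ 2, ρ, hρ0, fun y hy w hw => ?_⟩
  have hmem : ∀ w ∈ ball (0 : ℂ) ρ, y + w • h ∈ U ∩ {y | ‖f y‖ ≤ M} := by
    intro w hw
    apply hball
    rw [mem_ball, dist_eq_norm] at hy ⊢
    rw [mem_ball_zero_iff] at hw
    calc ‖y + w • h - x‖ = ‖(y - x) + w • h‖ := by congr 1; abel
      _ ≤ ‖y - x‖ + ‖w‖ * ‖h‖ := (norm_add_le _ _).trans_eq (by rw [norm_smul])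
      _ ≤ ρ + ρ * ‖h‖ := by gcongr
      _ < ε := by linarith
  refine ⟨(hmem w hw).1, ?_⟩
  have := norm_sub_sub_smul_deriv_le hρ0
    (fun w hw => (hf.hasDerivAt_line (hmem w hw).1).differentiableAt.differentiableWithinAt)
    (fun w hw => (hmem w hw).2) hw
  simpa [lineDeriv] using this

theorem lineDeriv_right [CompleteSpace F] (hf : GateauxHolomorphicOn f U) (hU : IsOpen U)
    (h : E) : GateauxHolomorphicOn (fun x => lineDeriv ℂ f x h) U where
  lineDifferentiableAt x hx k := by
    obtain ⟨C, ρ, hρ, H⟩ := hf.exists_norm_sub_sub_smul_lineDeriv_le hU hx h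
    have hline : Continuous fun z : ℂ => x + z • k := by fun_prop
    set V : Set ℂ := (fun z : ℂ => x + z • k) ⁻¹' (ball x ρ) with hV
    have hVo : IsOpen V := isOpen_ball.preimage hline
    have hmemU : ∀ z ∈ V, x + z • k ∈ U := fun z hz => by
      simpa using (H _ hz 0 (mem_ball_self hρ)).1
    have hlim : TendstoUniformlyOn
        (fun (w : ℂ) (z : ℂ) => w⁻¹ • (f (x + z • k + w • h) - f (x + z • k)))
        (fun z => lineDeriv ℂ f (x + z • k) h) (𝓝[≠] 0) V := by
      rw [Metric.tendstoUniformlyOn_iff]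
      intro ε hε
      have hC : Tendsto (fun w : ℂ => C * ‖w‖) (𝓝[≠] 0) (𝓝 0) := by
        have : Continuous fun w : ℂ => C * ‖w‖ := by fun_prop
        simpa using (this.tendsto 0).mono_left nhdsWithin_le_nhds
      filter_upwards [hC.eventually_lt_const hε, self_mem_nhdsWithin,
        mem_nhdsWithin_of_mem_nhds (ball_mem_nhds (0 : ℂ) hρ)] with w hw hw0 hwρ z hz
      have hw0 : w ≠ 0 := hw0
      refine lt_of_le_of_lt ?_ hw
      have h1 := (H _ hz w hwρ).2
      have h2 : w⁻¹ • (f (x + z • k + w • h) - f (x + z • k)) - lineDeriv ℂ f (x + z • k) h =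
          w⁻¹ • (f (x + z • k + w • h) - f (x + z • k) - w • lineDeriv ℂ f (x + z • k) h) := by
        rw [smul_sub _ _ (w • _), inv_smul_smul₀ hw0]
      rw [dist_comm, dist_eq_norm, h2, norm_smul, norm_inv]
      have : 0 < ‖w‖ := norm_pos_iff.2 hw0
      rw [inv_mul_le_iff₀ this]
      exact h1.trans_eq (by ring)
    have hdiff : ∀ᶠ w : ℂ in 𝓝[≠] 0, DifferentiableOn ℂ
        (fun z : ℂ => w⁻¹ • (f (x + z • k + w • h) - f (x + z • k))) V := by
      filter_upwards [mem_nhdsWithin_of_mem_nhds (ball_mem_nhds (0 : ℂ) hρ)] with w hw z hz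
      refine DifferentiableAt.differentiableWithinAt ?_
      refine DifferentiableAt.const_smul (.sub ?_ ?_) _
      · have hz' : x + w • h + z • k ∈ U := by
          simpa only [add_right_comm] using (H _ hz w hw).1
        simpa only [add_right_comm] using (hf.hasDerivAt_line hz').differentiableAt
      · exact (hf.hasDerivAt_line (hmemU z hz)).differentiableAt
    exact (hlim.tendstoLocallyUniformlyOn.differentiableOn hdiff hVo).differentiableAt
      (hVo.mem_nhds (by simpa [hV] using hρ))
  locallyBounded x hx := by
    obtain ⟨M, hM⟩ := hf.locallyBounded x hx
    obtain ⟨ε, hε, hball⟩ := Metric.mem_nhds_iff.1 (inter_mem (hU.mem_nhds hx) hM)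
    refine ⟨2 * M / (ε / 2) * ‖h‖, ?_⟩
    filter_upwards [ball_mem_nhds x (half_pos hε)] with y hy
    have hsub : ball y (ε / 2) ⊆ ball x ε := ball_subset_ball' (by
      linarith [mem_ball.1 hy])
    exact hf.norm_lineDeriv_le (half_pos hε) (fun z hz => (hball (hsub hz)).1)
      fun z hz => (hball (hsub hz)).2

theorem lineDeriv_add_right [CompleteSpace F] (hf : GateauxHolomorphicOn f U) (hU : IsOpen U)
    {x : E} (hx : x ∈ U) (a b : E) :
    lineDeriv ℂ f x (a + b) = lineDeriv ℂ f x a + lineDeriv ℂ f x b := by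
  obtain ⟨C, ρ, hρ, H⟩ := hf.exists_norm_sub_sub_smul_lineDeriv_le hU hx b
  have hline : Continuous fun z : ℂ => x + z • a := by fun_prop
  have hremainder : HasDerivAt (fun t : ℂ => f (x + t • a + t • b) - f (x + t • a)
      - t • lineDeriv ℂ f (x + t • a) b) 0 0 := by
    rw [hasDerivAt_iff_isLittleO]
    have hO : (fun t : ℂ => f (x + t • a + t • b) - f (x + t • a)
        - t • lineDeriv ℂ f (x + t • a) b) =O[𝓝 0] fun t : ℂ => t ^ 2 := by
      refine Asymptotics.IsBigO.of_bound C ?_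
      have hnear : ∀ᶠ t : ℂ in 𝓝 0, x + t • a ∈ ball x ρ :=
        hline.tendsto 0 (isOpen_ball.mem_nhds (by simpa using hρ))
      filter_upwards [hnear, ball_mem_nhds (0 : ℂ) hρ] with t ht htρ
      simpa using (H _ ht t htρ).2
    simpa using hO.trans_isLittleO (Asymptotics.isLittleO_pow_id one_lt_two)
  have hb : HasDerivAt (fun t : ℂ => t • lineDeriv ℂ f (x + t • a) b) (lineDeriv ℂ f x b) 0 := by
    have := (hasDerivAt_id' (0 : ℂ)).fun_smul
      ((hf.lineDeriv_right hU b).lineDifferentiableAt x hx a).hasLineDerivAt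
    simpa using this
  have ha : HasDerivAt (fun t : ℂ => f (x + t • a)) (lineDeriv ℂ f x a) 0 :=
    (hf.lineDifferentiableAt x hx a).hasLineDerivAt
  have hsum : HasLineDerivAt ℂ f (lineDeriv ℂ f x a + lineDeriv ℂ f x b) x (a + b) := by
    have := ha.add (hremainder.add hb)
    rw [zero_add] at this
    refine HasDerivAt.congr_of_eventuallyEq this (Eventually.of_forall fun t => ?_)
    simp [smul_add, add_assoc]
  exact hsum.lineDeriv

end GateauxHolomorphicOn

/-- `iteratedLineDeriv f v x` is the iterated complex directional derivative
`∂_{v 0} (∂_{v 1} (⋯ f))` at `x`. -/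
noncomputable def iteratedLineDeriv (f : E → F) : {n : ℕ} → (Fin n → E) → E → F
  | 0, _ => f
  | _ + 1, v => fun x => lineDeriv ℂ (iteratedLineDeriv f (Fin.tail v)) x (v 0)

namespace GateauxHolomorphicOn

variable {f : E → F} {U : Set E}

variable [CompleteSpace F]

protected theorem iteratedLineDeriv (hf : GateauxHolomorphicOn f U) (hU : IsOpen U) :
    ∀ {n : ℕ} (v : Fin n → E), GateauxHolomorphicOn (iteratedLineDeriv f v) U
  | 0, _ => hf
  | _ + 1, v => (hf.iteratedLineDeriv hU (Fin.tail v)).lineDeriv_right hU (v 0)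

theorem iteratedLineDeriv_update_add (hf : GateauxHolomorphicOn f U) (hU : IsOpen U) {n : ℕ}
    (v : Fin n → E) (i : Fin n) (a b : E) {x : E} (hx : x ∈ U) :
    iteratedLineDeriv f (update v i (a + b)) x =
      iteratedLineDeriv f (update v i a) x + iteratedLineDeriv f (update v i b) x := by
  induction n generalizing x with
  | zero => exact i.elim0
  | succ n ih =>
    cases i using Fin.cases with
    | zero =>
      simpa [iteratedLineDeriv] using
        (hf.iteratedLineDeriv hU (Fin.tail v)).lineDeriv_add_right hU hx a b
    | succ j =>
      have heq : iteratedLineDeriv f (update (Fin.tail v) j (a + b)) =ᶠ[𝓝 x]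
          fun y => iteratedLineDeriv f (update (Fin.tail v) j a) y +
            iteratedLineDeriv f (update (Fin.tail v) j b) y :=
        eventually_of_mem (hU.mem_nhds hx) fun y hy => ih (Fin.tail v) j hy
      have h0 : ∀ c, update v j.succ c 0 = v 0 := fun c =>
        update_of_ne (Fin.succ_ne_zero j).symm _ _
      simp only [iteratedLineDeriv, Fin.tail_update_succ, h0]
      rw [heq.lineDeriv_eq]
      exact HasLineDerivAt.lineDeriv (HasDerivAt.add
        ((hf.iteratedLineDeriv hU _).lineDifferentiableAt x hx _).hasLineDerivAt
        ((hf.iteratedLineDeriv hU _).lineDifferentiableAt x hx _).hasLineDerivAt)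

theorem iteratedLineDeriv_update_smul (hf : GateauxHolomorphicOn f U) (hU : IsOpen U) {n : ℕ}
    (v : Fin n → E) (i : Fin n) (c : ℂ) (a : E) {x : E} (hx : x ∈ U) :
    iteratedLineDeriv f (update v i (c • a)) x = c • iteratedLineDeriv f (update v i a) x := by
  induction n generalizing x with
  | zero => exact i.elim0
  | succ n ih =>
    cases i using Fin.cases with
    | zero => simp [iteratedLineDeriv, lineDeriv_smul]
    | succ j =>
      have heq : iteratedLineDeriv f (update (Fin.tail v) j (c • a)) =ᶠ[𝓝 x]
          fun y => c • iteratedLineDeriv f (update (Fin.tail v) j a) y :=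
        eventually_of_mem (hU.mem_nhds hx) fun y hy => ih (Fin.tail v) j hy
      have h0 : ∀ c, update v j.succ c 0 = v 0 := fun c =>
        update_of_ne (Fin.succ_ne_zero j).symm _ _
      simp only [iteratedLineDeriv, Fin.tail_update_succ, h0]
      rw [heq.lineDeriv_eq]
      exact HasLineDerivAt.lineDeriv (HasDerivAt.const_smul c
        ((hf.iteratedLineDeriv hU _).lineDifferentiableAt x hx _).hasLineDerivAt)

theorem norm_iteratedLineDeriv_le (hf : GateauxHolomorphicOn f U) (hU : IsOpen U) {M δ : ℝ}
    (hM : ∀ x ∈ U, ‖f x‖ ≤ M) (hδ : 0 < δ) {n : ℕ} (v : Fin n → E) {x : E} (hx : x ∈ U)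
    (hball : ball x (n * δ) ⊆ U) :
    ‖iteratedLineDeriv f v x‖ ≤ M * (2 / δ) ^ n * ∏ i, ‖v i‖ := by
  induction n generalizing x with
  | zero => simpa [iteratedLineDeriv] using hM x hx
  | succ n ih =>
    have hsub : ∀ y ∈ ball x δ, ball y (n * δ) ⊆ U := fun y hy =>
      (ball_subset_ball' (by push_cast; linarith [mem_ball.1 hy])).trans hball
    have hδU : ball x δ ⊆ U := (ball_subset_ball (by
      push_cast; nlinarith [n.cast_nonneg (α := ℝ)])).trans hball
    refine ((hf.iteratedLineDeriv hU (Fin.tail v)).norm_lineDeriv_le hδ hδU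
      fun y hy => ih (Fin.tail v) (hδU hy) (hsub y hy)).trans_eq ?_
    rw [Fin.prod_univ_succ, pow_succ]
    simp only [Fin.tail]
    ring

theorem iteratedDeriv_line (hf : GateauxHolomorphicOn f U) (hU : IsOpen U) (x h : E) (n : ℕ)
    {z : ℂ} (hz : x + z • h ∈ U) :
    iteratedDeriv n (fun w : ℂ => f (x + w • h)) z =
      iteratedLineDeriv f (fun _ : Fin n => h) (x + z • h) := by
  induction n generalizing z with
  | zero => simp [iteratedLineDeriv]
  | succ n ih =>
    have hline : Continuous fun z : ℂ => x + z • h := by fun_prop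
    have heq : iteratedDeriv n (fun w : ℂ => f (x + w • h)) =ᶠ[𝓝 z]
        fun w => iteratedLineDeriv f (fun _ : Fin n => h) (x + w • h) :=
      eventually_of_mem ((hU.preimage hline).mem_nhds hz) fun w hw => ih hw
    rw [iteratedDeriv_succ, heq.deriv_eq]
    exact ((hf.iteratedLineDeriv hU _).hasDerivAt_line hz).deriv

/-- The Taylor coefficients of a bounded Gâteaux holomorphic function are continuous multilinear
maps, with a geometric bound on their norms. -/
theorem exists_continuousMultilinearMap (hf : GateauxHolomorphicOn f U) (hU : IsOpen U) {M ρ : ℝ}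
    (hM0 : 0 ≤ M) (hM : ∀ x ∈ U, ‖f x‖ ≤ M) (hρ : 0 < ρ) {x : E} (hball : ball x ρ ⊆ U) (n : ℕ) :
    ∃ p : E [×n]→L[ℂ] F, (∀ v, p v = (n ! : ℂ)⁻¹ • iteratedLineDeriv f v x) ∧
      ‖p‖ ≤ M * (2 * Real.exp 1 / ρ) ^ n := by
  have hx : x ∈ U := hball (mem_ball_self hρ)
  have hbound : ∀ v : Fin n → E,
      ‖iteratedLineDeriv f v x‖ ≤ M * (2 * n / ρ) ^ n * ∏ i, ‖v i‖ := by
    intro v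
    rcases n.eq_zero_or_pos with rfl | hn
    · simpa [iteratedLineDeriv] using hM x hx
    · have hn' : (0 : ℝ) < n := by exact_mod_cast hn
      have := hf.norm_iteratedLineDeriv_le hU hM (div_pos hρ hn') v hx
        (by rwa [mul_div_cancel₀ _ hn'.ne'])
      rwa [div_div_eq_mul_div] at this
  let T : MultilinearMap ℂ (fun _ : Fin n => E) F :=
    { toFun := fun v => (n ! : ℂ)⁻¹ • iteratedLineDeriv f v x
      map_update_add' := fun {inst} v i a b => by
        obtain rfl := Subsingleton.elim inst (instDecidableEqFin n)
        rw [hf.iteratedLineDeriv_update_add hU v i a b hx, smul_add]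
      map_update_smul' := fun {inst} v i c a => by
        obtain rfl := Subsingleton.elim inst (instDecidableEqFin n)
        rw [hf.iteratedLineDeriv_update_smul hU v i c a hx, smul_comm] }
  have hT : ∀ v, ‖T v‖ ≤ M * (2 * Real.exp 1 / ρ) ^ n * ∏ i, ‖v i‖ := by
    intro v
    have hexp : (n : ℝ) ^ n / n ! ≤ Real.exp 1 ^ n := by
      rw [← Real.exp_nat_mul, mul_one]
      exact Real.pow_div_factorial_le_exp _ n.cast_nonneg n
    calc ‖T v‖ = (n ! : ℝ)⁻¹ * ‖iteratedLineDeriv f v x‖ := by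
          simp [T, norm_smul]
      _ ≤ (n ! : ℝ)⁻¹ * (M * (2 * n / ρ) ^ n * ∏ i, ‖v i‖) := by gcongr; exact hbound v
      _ = M * ((2 / ρ) ^ n * ((n : ℝ) ^ n / n !)) * ∏ i, ‖v i‖ := by
          rw [mul_div_right_comm, mul_pow]; ring
      _ ≤ M * ((2 / ρ) ^ n * Real.exp 1 ^ n) * ∏ i, ‖v i‖ := by gcongr
      _ = M * (2 * Real.exp 1 / ρ) ^ n * ∏ i, ‖v i‖ := by
          rw [← mul_pow, div_mul_eq_mul_div]
  exact ⟨T.mkContinuous _ hT, fun v => rfl, T.mkContinuous_norm_le (by positivity) hT⟩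

/-- A bounded Gâteaux holomorphic function on an open set is analytic. -/
theorem analyticAt_of_norm_le (hf : GateauxHolomorphicOn f U) (hU : IsOpen U) {M : ℝ}
    (hM : ∀ x ∈ U, ‖f x‖ ≤ M) {x : E} (hx : x ∈ U) : AnalyticAt ℂ f x := by
  obtain ⟨ρ, hρ, hball⟩ := Metric.isOpen_iff.1 hU x hx
  have hM0 : 0 ≤ M := (norm_nonneg _).trans (hM x hx)
  choose p hp hpnorm using hf.exists_continuousMultilinearMap hU hM0 hM hρ hball
  have hexp : 1 < Real.exp 1 := Real.one_lt_exp_iff.2 one_pos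
  set R : ℝ := ρ / (2 * Real.exp 1) with hR
  have hR0 : 0 < R := by positivity
  have hRρ : 2 * R ≤ ρ := by
    rw [hR, ← mul_div_assoc, div_le_iff₀ (by positivity)]
    nlinarith
  refine ⟨p, ENNReal.ofReal R, ?_, by simpa using hR0, fun {y} hy => ?_⟩
  · refine FormalMultilinearSeries.le_radius_of_bound p M fun n => ?_
    rw [Real.coe_toNNReal _ hR0.le]
    calc ‖p n‖ * R ^ n ≤ M * (2 * Real.exp 1 / ρ) ^ n * R ^ n := by gcongr; exact hpnorm n
      _ = M := by
        rw [mul_assoc, ← mul_pow, hR, div_mul_div_cancel₀' (by positivity), div_self hρ.ne',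
          one_pow, mul_one]
  · have hy' : ‖y‖ < R := by
      simpa [Metric.eball_ofReal] using hy
    have hmem : ∀ z ∈ ball (0 : ℂ) 2, x + z • y ∈ U := by
      intro z hz
      apply hball
      rw [mem_ball_zero_iff] at hz
      rw [mem_ball, dist_eq_norm, add_sub_cancel_left, norm_smul]
      exact (mul_lt_mul'' hz hy' (norm_nonneg _) (norm_nonneg _)).trans_le hRρ
    have hsum := Complex.hasSum_taylorSeries_on_ball (f := fun z : ℂ => f (x + z • y))
      (fun z hz => (hf.hasDerivAt_line (hmem z hz)).differentiableAt.differentiableWithinAt)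
      (z := 1) (by simp)
    convert hsum using 1
    · ext n
      rw [hf.iteratedDeriv_line hU x y n (by simpa using hx), hp]
      simp
    · simp

end GateauxHolomorphicOn

end GateauxHolomorphic

/-- A locally bounded, finitely (Gâteaux) holomorphic function on a ball of a complex Banach
space is analytic on that ball (Douady). -/
theorem analytic_of_bounded_gateaux_holomorphic
    (E : Type*) [NormedAddCommGroup E] [NormedSpace ℂ E] [CompleteSpace E]
    (A : E) (r M : ℝ) (hr : 0 < r) (hM : 0 ≤ M)
    (f : E → ℂ)
    (hbound : ∀ x ∈ ball A r, ‖f x‖ ≤ M)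
    (hgateaux : ∀ x ∈ ball A r, ∀ h : E,
      AnalyticAt ℂ (fun z : ℂ => f (x + z • h)) 0) :
    ∀ x ∈ ball A r, AnalyticAt ℂ f x := by
  have hf : GateauxHolomorphicOn f (ball A r) :=
    ⟨fun x hx h => (hgateaux x hx h).differentiableAt,
      fun x hx => ⟨M, eventually_of_mem (isOpen_ball.mem_nhds hx) hbound⟩⟩
  exact fun x hx => hf.analyticAt_of_norm_le isOpen_ball hbound hx
end

section
/- Let E be a complex Banach space and f : E → ℂ a function. Then f is analytic on all of E if and only if for every map γ : ℂ → E that is analytic on the open unit disc 𝔻 ⊂ ℂ, the composite f ∘ γ : 𝔻 → ℂ is analytic on 𝔻. -/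
open Metric

section

open Set Filter Topology Function MeasureTheory Real

/-- Second order Taylor estimate for bounded holomorphic functions on a disc. -/
lemma norm_sub_sub_deriv_le {φ : ℂ → ℂ} {ρ M : ℝ} (hd : DifferentiableOn ℂ φ (ball 0 ρ))
    (hM : ∀ z ∈ ball (0 : ℂ) ρ, ‖φ z‖ ≤ M) {h : ℂ} (hh : h ∈ ball (0 : ℂ) ρ) :
    ‖φ h - φ 0 - h * deriv φ 0‖ ≤ 4 * M * (‖h‖ / ρ) ^ 2 := by
  have hρ : 0 < ρ := pos_of_mem_ball hh
  have h0 : (0 : ℂ) ∈ ball (0 : ℂ) ρ := mem_ball_self hρ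
  have hφ0 : DifferentiableAt ℂ φ 0 := hd.differentiableAt (isOpen_ball.mem_nhds h0)
  have hmaps : MapsTo φ (ball 0 ρ) (closedBall (φ 0) (2 * M)) := by
    intro z hz
    rw [mem_closedBall, dist_eq_norm]
    linarith [norm_sub_le (φ z) (φ 0), hM z hz, hM 0 h0]
  have hder : ‖deriv φ 0‖ ≤ 2 * M / ρ := Complex.norm_deriv_le_div_of_mapsTo_ball hd hmaps hρ
  have key := Complex.dist_le_mul_div_pow_of_mapsTo_ball_of_isLittleO (n := 1) (c := (0 : ℂ))
    (f := fun z => φ z - z * deriv φ 0) (R₁ := ρ) (R₂ := 4 * M) (z := h) (by fun_prop) ?_ ?_ hh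
  · simpa [dist_eq_norm, sub_right_comm] using key
  · intro z hz
    have h1 := hmaps hz
    rw [mem_closedBall, dist_eq_norm] at h1 ⊢
    have h2 : ‖z * deriv φ 0‖ ≤ 2 * M := by
      rw [norm_mul]
      calc ‖z‖ * ‖deriv φ 0‖ ≤ ρ * (2 * M / ρ) := by
            gcongr
            exact (mem_ball_zero_iff.1 hz).le
        _ = 2 * M := by field_simp
    have h3 : φ z - z * deriv φ 0 - (φ 0 - 0 * deriv φ 0) = (φ z - φ 0) - z * deriv φ 0 := by ring
    rw [h3]
    linarith [norm_sub_le (φ z - φ 0) (z * deriv φ 0)]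
  · have := hφ0.hasDerivAt.isLittleO
    refine (this.norm_right.congr ?_ ?_)
    · intro z; simp; ring
    · intro z; simp

variable {E : Type*} [NormedAddCommGroup E] [NormedSpace ℂ E]

/-- Gateaux holomorphic and locally bounded functions on a set. -/
structure GateauxHol (U : Set E) (g : E → ℂ) : Prop where
  diff : ∀ x ∈ U, ∀ v, LineDifferentiableAt ℂ g x v
  bdd : ∀ x ∈ U, ∃ M, ∀ᶠ y in 𝓝 x, ‖g y‖ ≤ M

lemma lineDeriv_line {g : E → ℂ} {x v : E} {z : ℂ} :
    lineDeriv ℂ g (x + z • v) v = deriv (fun t : ℂ => g (x + t • v)) z := by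
  have : (fun t : ℂ => g (x + z • v + t • v)) = fun t => (fun s : ℂ => g (x + s • v)) (z + t) := by
    ext t; simp only [add_smul, add_assoc]
  rw [lineDeriv, this]
  exact (deriv_comp_const_add (fun s : ℂ => g (x + s • v)) z 0).trans (by rw [add_zero])

lemma LineDifferentiableAt.differentiableAt_line {g : E → ℂ} {x v : E} {z : ℂ}
    (h : LineDifferentiableAt ℂ g (x + z • v) v) :
    DifferentiableAt ℂ (fun t : ℂ => g (x + t • v)) z := by
  have h1 : DifferentiableAt ℂ (fun t : ℂ => g (x + z • v + t • v)) (z - z) := by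
    rw [sub_self]; exact h
  have h2 := h1.comp (f := fun t : ℂ => t - z) z (by fun_prop)
  refine h2.congr_of_eventuallyEq (Eventually.of_forall fun t => ?_)
  simp only [Function.comp, add_assoc, ← add_smul]
  congr 3; ring

lemma add_smul_mem_ball {x y v : E} {R ρ : ℝ} (hv : ρ * ‖v‖ ≤ R / 2) (hy : y ∈ ball x (R / 2))
    {h : ℂ} (hh : h ∈ ball (0 : ℂ) ρ) : y + h • v ∈ ball x R := by
  rw [mem_ball, dist_eq_norm] at hy ⊢
  rw [mem_ball_zero_iff] at hh
  have h1 : ‖h • v‖ ≤ ρ * ‖v‖ := by rw [norm_smul]; gcongr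
  calc ‖y + h • v - x‖ = ‖(y - x) + h • v‖ := by congr 1; abel
    _ ≤ ‖y - x‖ + ‖h • v‖ := norm_add_le _ _
    _ < R := by linarith

namespace GateauxHol

variable {U : Set E} {g g₁ g₂ : E → ℂ}

lemma exists_radius (hU : IsOpen U) (hg : GateauxHol U g) {x : E} (hx : x ∈ U) :
    ∃ R > 0, ∃ M, ball x R ⊆ U ∧ ∀ y ∈ ball x R, ‖g y‖ ≤ M := by
  obtain ⟨M, hM⟩ := hg.bdd x hx
  obtain ⟨R, hR, hb⟩ := Metric.eventually_nhds_iff_ball.1 (hM.and (hU.mem_nhds hx))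
  exact ⟨R, hR, M, fun y hy => (hb y hy).2, fun y hy => (hb y hy).1⟩

/-- Uniform first order expansion along a direction. -/
lemma exists_expansion (hU : IsOpen U) (hg : GateauxHol U g) {x : E} (hx : x ∈ U) (v : E) :
    ∃ C, ∃ ρ > 0, ∀ᶠ y in 𝓝 x, ∀ h ∈ ball (0 : ℂ) ρ,
      ‖g (y + h • v) - g y - h * lineDeriv ℂ g y v‖ ≤ C * ‖h‖ ^ 2 := by
  obtain ⟨R, hR, M, hRU, hM⟩ := hg.exists_radius hU hx
  set ρ := R / 2 / (‖v‖ + 1) with hρ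
  have hvpos : 0 < ‖v‖ + 1 := by positivity
  have hρ0 : 0 < ρ := by positivity
  have hρv : ρ * ‖v‖ ≤ R / 2 := by
    rw [hρ, div_mul_eq_mul_div, div_le_iff₀ hvpos]
    nlinarith
  refine ⟨4 * M / ρ ^ 2, ρ, hρ0, ?_⟩
  filter_upwards [ball_mem_nhds x (half_pos hR)] with y hy h hh
  have := norm_sub_sub_deriv_le (φ := fun t : ℂ => g (y + t • v)) (ρ := ρ) (M := M)
    (fun z hz => (hg.diff _ (hRU (add_smul_mem_ball hρv hy hz)) v).differentiableAt_line.differentiableWithinAt)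
    (fun z hz => hM _ (add_smul_mem_ball hρv hy hz)) hh
  simp only [zero_smul, add_zero] at this
  refine this.trans_eq ?_
  field_simp

lemma norm_lineDeriv_le {c : E} {R M δ : ℝ} (hδ : 0 < δ)
    (hd : ∀ x ∈ ball c R, ∀ v, LineDifferentiableAt ℂ g x v)
    (hM : ∀ x ∈ ball c R, ‖g x‖ ≤ M) {y : E} (hy : y ∈ ball c (R - δ)) (v : E) :
    ‖lineDeriv ℂ g y v‖ ≤ M * ‖v‖ / δ := by
  rcases eq_or_ne v 0 with rfl | hv
  · simp [lineDeriv_zero]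
  have hv' : 0 < ‖v‖ := norm_pos_iff.2 hv
  have hmem : ∀ t ∈ closedBall (0 : ℂ) (δ / ‖v‖), y + t • v ∈ ball c R := by
    intro t ht
    rw [mem_closedBall_zero_iff, le_div_iff₀ hv', ← norm_smul] at ht
    rw [mem_ball, dist_eq_norm] at hy ⊢
    calc ‖y + t • v - c‖ = ‖(y - c) + t • v‖ := by congr 1; abel
      _ ≤ ‖y - c‖ + ‖t • v‖ := norm_add_le _ _
      _ < R := by linarith
  have := Complex.norm_deriv_le_of_forall_mem_sphere_norm_le (c := (0 : ℂ)) (R := δ / ‖v‖) (C := M)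
    (f := fun t : ℂ => g (y + t • v)) (by positivity) ?_
    (fun t ht => hM _ (hmem t (sphere_subset_closedBall ht)))
  · refine this.trans_eq ?_
    field_simp
  · apply DifferentiableOn.diffContOnCl
    rw [closure_ball _ (by positivity)]
    exact fun t ht => (hd _ (hmem t ht) v).differentiableAt_line.differentiableWithinAt

/-- Directional derivatives of a locally bounded Gateaux holomorphic function are of the same
kind. -/
lemma lineDeriv (hU : IsOpen U) (hg : GateauxHol U g) (v : E) :
    GateauxHol U (fun x => lineDeriv ℂ g x v) := by
  refine ⟨fun x hx u => ?_, fun x hx => ?_⟩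
  · obtain ⟨C, ρ, hρ, hev⟩ := hg.exists_expansion hU hx v
    have hcont : Tendsto (fun t : ℂ => x + t • u) (𝓝 0) (𝓝 x) := by
      have : Continuous (fun t : ℂ => x + t • u) := by fun_prop
      simpa using this.tendsto 0
    have hev' : ∀ᶠ y in 𝓝 x, y ∈ U := hU.mem_nhds hx
    have hgood : ∀ᶠ t : ℂ in 𝓝 0, x + t • u ∈ U ∧ ∀ h ∈ ball (0 : ℂ) ρ,
        ‖g (x + t • u + h • v) - g (x + t • u) - h * _root_.lineDeriv ℂ g (x + t • u) v‖
          ≤ C * ‖h‖ ^ 2 := hcont.eventually (hev'.and hev)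
    have hjoint : Tendsto (fun p : ℂ × ℂ => x + p.1 • u + p.2 • v) (𝓝 0 ×ˢ 𝓝 0) (𝓝 x) := by
      have : Continuous (fun p : ℂ × ℂ => x + p.1 • u + p.2 • v) := by fun_prop
      rw [← nhds_prod_eq]
      simpa using this.tendsto (0, 0)
    obtain ⟨P, hP, Q, hQ, hPQ⟩ := eventually_prod_iff.1 (hjoint.eventually hev')
    obtain ⟨r, hr, hball⟩ := Metric.eventually_nhds_iff_ball.1 (hgood.and hP)
    have hlim : TendstoLocallyUniformlyOn
        (fun (h : ℂ) (t : ℂ) => h⁻¹ * (g (x + t • u + h • v) - g (x + t • u)))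
        (fun t => _root_.lineDeriv ℂ g (x + t • u) v) (𝓝[≠] 0) (ball 0 r) := by
      apply TendstoUniformlyOn.tendstoLocallyUniformlyOn
      rw [Metric.tendstoUniformlyOn_iff]
      intro ε hε
      have hsmall : ∀ᶠ h : ℂ in 𝓝 0, C * ‖h‖ < ε := by
        have : Continuous (fun h : ℂ => C * ‖h‖) := by fun_prop
        have := this.tendsto 0
        simp only [norm_zero, mul_zero] at this
        exact this.eventually (gt_mem_nhds hε)
      filter_upwards [nhdsWithin_le_nhds hsmall, nhdsWithin_le_nhds (ball_mem_nhds (0 : ℂ) hρ),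
        self_mem_nhdsWithin] with h h1 h2 h3 t ht
      have h3 : h ≠ 0 := h3
      have h4 := (hball t ht).1.2 h h2
      rw [dist_comm, dist_eq_norm]
      have h5 : h⁻¹ * (g (x + t • u + h • v) - g (x + t • u)) - _root_.lineDeriv ℂ g (x + t • u) v
          = h⁻¹ * (g (x + t • u + h • v) - g (x + t • u)
              - h * _root_.lineDeriv ℂ g (x + t • u) v) := by
        field_simp
      rw [h5, norm_mul, norm_inv]
      have h6 : 0 < ‖h‖ := norm_pos_iff.2 h3
      calc ‖h‖⁻¹ * _ ≤ ‖h‖⁻¹ * (C * ‖h‖ ^ 2) := by gcongr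
        _ = C * ‖h‖ := by field_simp
        _ < ε := h1
    have hdiff := hlim.differentiableOn (by
      filter_upwards [nhdsWithin_le_nhds hQ] with h hh t ht
      have a1 : DifferentiableAt ℂ (fun t : ℂ => g (x + t • u)) t :=
        (hg.diff _ (hball t ht).1.1 u).differentiableAt_line
      have a2 : DifferentiableAt ℂ (fun t : ℂ => g (x + h • v + t • u)) t := by
        refine (hg.diff _ ?_ u).differentiableAt_line
        have := hPQ (hball t ht).2 hh
        rwa [add_right_comm] at this
      have a3 : DifferentiableAt ℂ (fun t : ℂ => g (x + t • u + h • v)) t := by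
        simpa only [add_right_comm] using a2
      exact ((a3.sub a1).const_mul _).differentiableWithinAt) isOpen_ball
    exact hdiff.differentiableAt (ball_mem_nhds 0 hr)
  · obtain ⟨R, hR, M, hRU, hM⟩ := hg.exists_radius hU hx
    refine ⟨M * ‖v‖ / (R / 2), ?_⟩
    filter_upwards [ball_mem_nhds x (half_pos hR)] with y hy
    exact norm_lineDeriv_le (half_pos hR) (fun z hz => hg.diff z (hRU hz)) hM
      (by rwa [sub_half]) v

lemma lineDeriv_add (hU : IsOpen U) (hg : GateauxHol U g) {x : E} (hx : x ∈ U) (u v : E) :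
    _root_.lineDeriv ℂ g x (u + v) = _root_.lineDeriv ℂ g x u + _root_.lineDeriv ℂ g x v := by
  obtain ⟨C, ρ, hρ, hev⟩ := hg.exists_expansion hU hx v
  have hcont : Tendsto (fun t : ℂ => x + t • u) (𝓝 0) (𝓝 x) := by
    have : Continuous (fun t : ℂ => x + t • u) := by fun_prop
    simpa using this.tendsto 0
  have huv := (hg.diff x hx (u + v)).hasLineDerivAt.tendsto_slope_zero
  have hu := (hg.diff x hx u).hasLineDerivAt.tendsto_slope_zero
  have hv : Tendsto (fun t : ℂ => _root_.lineDeriv ℂ g (x + t • u) v) (𝓝[≠] 0)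
      (𝓝 (_root_.lineDeriv ℂ g x v)) := by
    have := ((hg.lineDeriv hU v).diff x hx u).continuousAt.tendsto
    simp only [zero_smul, add_zero] at this
    exact this.mono_left nhdsWithin_le_nhds
  have hrem : Tendsto (fun t : ℂ => t⁻¹ * (g (x + t • u + t • v) - g (x + t • u)
      - t * _root_.lineDeriv ℂ g (x + t • u) v)) (𝓝[≠] 0) (𝓝 0) := by
    have hC : Tendsto (fun t : ℂ => C * ‖t‖) (𝓝[≠] 0) (𝓝 0) := by
      have : Continuous (fun h : ℂ => C * ‖h‖) := by fun_prop
      have := this.tendsto 0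
      simp only [norm_zero, mul_zero] at this
      exact this.mono_left nhdsWithin_le_nhds
    refine squeeze_zero_norm' ?_ hC
    filter_upwards [nhdsWithin_le_nhds (hcont.eventually hev),
      nhdsWithin_le_nhds (ball_mem_nhds (0 : ℂ) hρ), self_mem_nhdsWithin] with t h1 h2 h3
    have h6 : 0 < ‖t‖ := norm_pos_iff.2 h3
    rw [norm_mul, norm_inv]
    calc ‖t‖⁻¹ * _ ≤ ‖t‖⁻¹ * (C * ‖t‖ ^ 2) := by gcongr; exact h1 t h2
      _ = C * ‖t‖ := by field_simp
  have hsum := (hu.add hv).add hrem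
  rw [add_zero] at hsum
  refine tendsto_nhds_unique huv (hsum.congr' ?_)
  filter_upwards [self_mem_nhdsWithin] with t ht
  have ht : t ≠ 0 := ht
  simp only [smul_eq_mul, smul_add, ← add_assoc]
  field_simp
  ring

end GateauxHol

/-- Iterated directional derivatives. -/
noncomputable def iterLineDeriv (g : E → ℂ) : (n : ℕ) → (Fin n → E) → E → ℂ
  | 0, _ => g
  | n + 1, v => fun x => lineDeriv ℂ (iterLineDeriv g n (Fin.tail v)) x (v 0)

lemma iterLineDeriv_const (g : E → ℂ) (n : ℕ) (x v : E) (z : ℂ) :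
    iterLineDeriv g n (fun _ => v) (x + z • v) =
      iteratedDeriv n (fun t : ℂ => g (x + t • v)) z := by
  induction n generalizing z with
  | zero => simp [iterLineDeriv]
  | succ n ih =>
    rw [iteratedDeriv_succ, ← funext ih]
    exact lineDeriv_line

namespace GateauxHol

variable {U : Set E} {g : E → ℂ}

lemma iterLineDeriv (hU : IsOpen U) (hg : GateauxHol U g) (n : ℕ) (v : Fin n → E) :
    GateauxHol U (iterLineDeriv g n v) := by
  induction n with
  | zero => exact hg
  | succ n ih => exact (ih (Fin.tail v)).lineDeriv hU (v 0)

lemma iterLineDeriv_update_add (hU : IsOpen U) (hg : GateauxHol U g) (n : ℕ) (v : Fin n → E)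
    (i : Fin n) (a b : E) {x : E} (hx : x ∈ U) :
    _root_.iterLineDeriv g n (update v i (a + b)) x =
      _root_.iterLineDeriv g n (update v i a) x + _root_.iterLineDeriv g n (update v i b) x := by
  induction n generalizing x with
  | zero => exact i.elim0
  | succ n ih =>
    simp only [_root_.iterLineDeriv]
    cases i using Fin.cases with
    | zero =>
      simp only [Fin.tail_update_zero, update_self]
      exact (hg.iterLineDeriv hU n _).lineDeriv_add hU hx a b
    | succ i =>
      simp only [Fin.tail_update_succ, update_of_ne (Fin.succ_ne_zero i).symm]
      have hev : _root_.iterLineDeriv g n (update (Fin.tail v) i (a + b)) =ᶠ[𝓝 x]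
          fun y => _root_.iterLineDeriv g n (update (Fin.tail v) i a) y +
            _root_.iterLineDeriv g n (update (Fin.tail v) i b) y := by
        filter_upwards [hU.mem_nhds hx] with y hy using ih _ _ hy
      rw [hev.lineDeriv_eq]
      exact ((((hg.iterLineDeriv hU n _).diff x hx (v 0)).hasLineDerivAt).add
        (((hg.iterLineDeriv hU n _).diff x hx (v 0)).hasLineDerivAt)).deriv

lemma iterLineDeriv_update_smul (hU : IsOpen U) (hg : GateauxHol U g) (n : ℕ) (v : Fin n → E)
    (i : Fin n) (c : ℂ) (a : E) {x : E} (hx : x ∈ U) :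
    _root_.iterLineDeriv g n (update v i (c • a)) x =
      c * _root_.iterLineDeriv g n (update v i a) x := by
  induction n generalizing x with
  | zero => exact i.elim0
  | succ n ih =>
    simp only [_root_.iterLineDeriv]
    cases i using Fin.cases with
    | zero =>
      simp only [Fin.tail_update_zero, update_self]
      exact lineDeriv_smul
    | succ i =>
      simp only [Fin.tail_update_succ, update_of_ne (Fin.succ_ne_zero i).symm]
      have hev : _root_.iterLineDeriv g n (update (Fin.tail v) i (c • a)) =ᶠ[𝓝 x]
          fun y => c * _root_.iterLineDeriv g n (update (Fin.tail v) i a) y := by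
        filter_upwards [hU.mem_nhds hx] with y hy using ih _ _ hy
      rw [hev.lineDeriv_eq]
      exact ((((hg.iterLineDeriv hU n _).diff x hx (v 0)).hasLineDerivAt).const_mul c).deriv

lemma norm_iterLineDeriv_le {c : E} {R M δ : ℝ} (hδ : 0 < δ) (hg : GateauxHol (ball c R) g)
    (hM : ∀ x ∈ ball c R, ‖g x‖ ≤ M) (n : ℕ) (v : Fin n → E) {y : E}
    (hy : y ∈ ball c (R - n * δ)) :
    ‖_root_.iterLineDeriv g n v y‖ ≤ M / δ ^ n * ∏ i, ‖v i‖ := by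
  induction n generalizing y with
  | zero => simpa [_root_.iterLineDeriv] using hM y (by simpa using hy)
  | succ n ih =>
    have hsub : ball c (R - n * δ) ⊆ ball c R := ball_subset_ball (by
      have : 0 ≤ n * δ := by positivity
      linarith)
    have := norm_lineDeriv_le (g := _root_.iterLineDeriv g n (Fin.tail v)) (c := c) (R := R - n * δ)
      (M := M / δ ^ n * ∏ i, ‖Fin.tail v i‖) (y := y) hδ
      (fun x hx => (hg.iterLineDeriv isOpen_ball n _).diff x (hsub hx))
      (fun x hx => ih _ hx) (by convert hy using 2; push_cast; ring) (v 0)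
    refine this.trans_eq ?_
    rw [Fin.prod_univ_succ]
    simp only [Fin.tail]
    field_simp
    ring

/-- A locally bounded Gateaux holomorphic function is analytic. -/
theorem analyticAt (hU : IsOpen U) (hg : GateauxHol U g) {x : E} (hx : x ∈ U) :
    AnalyticAt ℂ g x := by
  obtain ⟨R, hR, M, hRU, hM⟩ := hg.exists_radius hU hx
  have hxR : x ∈ ball x R := mem_ball_self hR
  have hM0 : 0 ≤ M := (norm_nonneg _).trans (hM x hxR)
  have hg' : GateauxHol (ball x R) g := ⟨fun y hy => hg.diff y (hRU hy), fun y hy => hg.bdd y (hRU hy)⟩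
  let D (n : ℕ) : MultilinearMap ℂ (fun _ : Fin n => E) ℂ :=
    { toFun := fun v => _root_.iterLineDeriv g n v x
      map_update_add' := fun {inst} v i a b => by
        rw [Subsingleton.elim inst (instDecidableEqFin n)]
        exact hg.iterLineDeriv_update_add hU n v i a b hx
      map_update_smul' := fun {inst} v i c a => by
        rw [Subsingleton.elim inst (instDecidableEqFin n)]
        exact hg.iterLineDeriv_update_smul hU n v i c a hx }
  have hD (n : ℕ) (v : Fin n → E) : ‖D n v‖ ≤ M * ((n + 1) / R) ^ n * ∏ i, ‖v i‖ := by
    have hn : (0 : ℝ) < n + 1 := by positivity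
    have := norm_iterLineDeriv_le (g := g) (c := x) (R := R) (M := M) (δ := R / (n + 1))
      (by positivity) hg' hM n v (y := x) (mem_ball_self (by
        rw [sub_pos, ← mul_div_assoc, div_lt_iff₀ hn]; nlinarith))
    refine this.trans_eq ?_
    rw [div_pow, div_pow]
    field_simp
  let p : FormalMultilinearSeries ℂ E ℂ := fun n =>
    ((n.factorial : ℂ)⁻¹) • (D n).mkContinuous (M * ((n + 1) / R) ^ n) (hD n)
  have hp (n : ℕ) : ‖p n‖ ≤ M * ((n + 1) / R) ^ n / n.factorial := by
    rw [norm_smul, norm_inv, Complex.norm_natCast, inv_mul_eq_div]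
    gcongr
    exact MultilinearMap.mkContinuous_norm_le _ (by positivity) _
  let r : NNReal := ⟨R / Real.exp 1, by positivity⟩
  have hr : 0 < r := by
    rw [← NNReal.coe_pos]; exact div_pos hR (Real.exp_pos 1)
  refine ⟨p, r, ?_, by exact_mod_cast hr, fun {y} hy => ?_⟩
  · refine p.le_radius_of_bound (M * Real.exp 1) fun n => ?_
    have h1 := Real.pow_div_factorial_le_exp ((n : ℝ) + 1) (by positivity) n
    have h2 : Real.exp ((n : ℝ) + 1) = Real.exp 1 ^ n * Real.exp 1 := by
      rw [Real.exp_add, ← Real.exp_nat_mul, mul_one]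
    rw [h2] at h1
    calc ‖p n‖ * (r : ℝ) ^ n ≤ M * ((n + 1) / R) ^ n / n.factorial * (R / Real.exp 1) ^ n := by
          gcongr
          · exact hp n
          · exact le_rfl
      _ = M * (((n : ℝ) + 1) ^ n / n.factorial / Real.exp 1 ^ n) := by
          rw [div_pow, div_pow]; field_simp
      _ ≤ M * Real.exp 1 := by
          gcongr
          rw [div_le_iff₀ (by positivity)]
          linarith
  · have hy' : ‖y‖ < R := by
      rw [eball_coe, mem_ball_zero_iff] at hy
      refine hy.trans_le (div_le_self hR.le ?_)
      exact Real.one_le_exp zero_le_one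
    obtain ⟨ρ, hρ1, hρ⟩ : ∃ ρ : ℝ, 1 < ρ ∧ ρ * ‖y‖ < R := by
      rcases eq_or_ne y 0 with rfl | hy0
      · exact ⟨2, by norm_num, by simpa using hR⟩
      · have hy0 : 0 < ‖y‖ := norm_pos_iff.2 hy0
        obtain ⟨ρ, h1, h2⟩ := exists_between ((one_lt_div hy0).2 hy')
        exact ⟨ρ, h1, (lt_div_iff₀ hy0).1 h2⟩
    have hdiff : DifferentiableOn ℂ (fun t : ℂ => g (x + t • y)) (ball 0 ρ) := by
      intro t ht
      refine (hg.diff _ (hRU ?_) y).differentiableAt_line.differentiableWithinAt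
      rw [mem_ball_zero_iff] at ht
      rw [mem_ball, dist_eq_norm, add_sub_cancel_left, norm_smul]
      exact (mul_le_mul_of_nonneg_right ht.le (norm_nonneg y)).trans_lt hρ
    have := Complex.hasSum_taylorSeries_on_ball hdiff (z := 1) (by simpa using hρ1)
    simp only [sub_zero, one_pow, one_smul] at this
    refine this.congr_fun ?_
    intro n
    have := iterLineDeriv_const g n x y 0
    rw [zero_smul, add_zero] at this
    simp only [p, smul_apply, MultilinearMap.coe_mkContinuous, D,
      MultilinearMap.coe_mk]
    rw [this]

end GateauxHol

/-- Subharmonicity of positive powers of the modulus of a holomorphic function. -/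
lemma rpow_norm_le_circleAverage {f : ℂ → ℂ} {c : ℂ} {r p : ℝ} (hr : 0 < r) (hp : 0 < p)
    (hf : AnalyticOnNhd ℂ f (closedBall c r)) :
    ‖f c‖ ^ p ≤ circleAverage (fun z => ‖f z‖ ^ p) c r := by
  have hcont : ContinuousOn (fun z => ‖f z‖ ^ p) (sphere c r) :=
    ((hf.continuousOn.mono sphere_subset_closedBall).norm).rpow_const fun _ _ => Or.inr hp.le
  have hint : CircleIntegrable (fun z => ‖f z‖ ^ p) c r := hcont.circleIntegrable hr.le
  rcases eq_or_ne (f c) 0 with h0 | h0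
  · rw [h0, norm_zero, zero_rpow hp.ne']
    exact circleAverage_nonneg_of_nonneg fun z _ => by positivity
  set A := log ‖f c‖ with hA
  have habs : |r| = r := abs_of_pos hr
  have hf' : AnalyticOnNhd ℂ f (closedBall c |r|) := by rwa [habs]
  have hJ : A ≤ circleAverage (fun z => log ‖f z‖) c r := by
    rw [hf'.circleAverage_log_norm hr.ne' h0]
    refine le_add_of_nonneg_left (finsum_nonneg fun u => ?_)
    by_cases hu : u ∈ closedBall c |r|
    · refine mul_nonneg ?_ ?_
      · exact_mod_cast (MeromorphicOn.AnalyticOnNhd.divisor_nonneg hf') u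
      · rcases eq_or_ne u c with rfl | huc
        · simp
        · have : 0 < ‖c - u‖ := norm_pos_iff.2 (sub_ne_zero.2 huc.symm)
          apply log_nonneg
          rw [← div_eq_mul_inv, one_le_div this]
          rw [habs, mem_closedBall, dist_comm, dist_eq_norm] at hu
          exact hu
    · rw [Function.locallyFinsuppWithin.apply_eq_zero_of_notMem _ hu]; simp
  set l : ℂ → ℝ := fun z => if f z = 0 then A - 1 / p else log ‖f z‖ with hl
  have hcod : (fun z => log ‖f z‖) =ᶠ[codiscreteWithin (sphere c |r|)] l := by
    have hpre : IsPreconnected (closedBall c |r|) := (convex_closedBall c |r|).isPreconnected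
    rcases hf'.eqOn_zero_or_eventually_ne_zero_of_preconnected hpre with h | h
    · exact absurd (h (mem_closedBall_self (abs_nonneg r))) h0
    · filter_upwards [codiscreteWithin_mono sphere_subset_closedBall h] with z hz
      simp [hl, hz]
  have hlint : CircleIntegrable (fun z => log ‖f z‖) c r :=
    MeromorphicOn.circleIntegrable_log_norm_of_nonneg
      (fun z hz => (hf z (sphere_subset_closedBall hz)).meromorphicAt) hr.le
  rw [circleAverage_congr_codiscreteWithin hcod hr.ne'] at hJ
  have hlint' := hlint.congr_codiscreteWithin hcod
  have hpt : ∀ z ∈ sphere c |r|, l z ≤ ((fun _ : ℂ => A - 1 / p) +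
      (exp (-(A * p)) / p) • (fun z : ℂ => ‖f z‖ ^ p) : ℂ → ℝ) z := by
    intro z _
    simp only [Pi.add_apply, Pi.smul_apply, smul_eq_mul, hl]
    split_ifs with hz
    · exact le_add_of_nonneg_right (by positivity)
    · have hz' : 0 < ‖f z‖ := norm_pos_iff.2 hz
      have h1 := add_one_le_exp ((log ‖f z‖ - A) * p)
      rw [rpow_def_of_pos hz', div_mul_eq_mul_div, ← exp_add]
      have h2 : -(A * p) + log ‖f z‖ * p = (log ‖f z‖ - A) * p := by ring
      rw [h2]
      have h3 : log ‖f z‖ = A - 1 / p + ((log ‖f z‖ - A) * p + 1) / p := by field_simp; ring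
      rw [h3]
      have : ((log ‖f z‖ - A) * p + 1) / p ≤ exp ((log ‖f z‖ - A) * p) / p := by gcongr
      rw [← h3]; linarith
  have hmono := circleAverage_mono hlint' ((circleIntegrable_const _ _ _).add (hint.const_smul)) hpt
  rw [circleAverage_add (circleIntegrable_const _ _ _) hint.const_smul, circleAverage_const,
    circleAverage_smul, smul_eq_mul] at hmono
  have h4 := hJ.trans hmono
  have h5 : ‖f c‖ ^ p = exp (A * p) := rpow_def_of_pos (norm_pos_iff.2 h0) p
  rw [h5]
  have h6 : 1 ≤ exp (-(A * p)) * circleAverage (fun z => ‖f z‖ ^ p) c r := by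
    have : 1 / p ≤ exp (-(A * p)) / p * circleAverage (fun z => ‖f z‖ ^ p) c r := by linarith
    rw [div_mul_eq_mul_div] at this
    exact (div_le_div_iff_of_pos_right hp).1 this
  calc exp (A * p) = exp (A * p) * 1 := by ring
    _ ≤ exp (A * p) * (exp (-(A * p)) * circleAverage (fun z => ‖f z‖ ^ p) c r) := by gcongr
    _ = _ := by rw [← mul_assoc, ← exp_add]; simp

/-- Mean value inequality over discs for positive powers of the modulus. -/
lemma rpow_norm_le_lintegral_ball {f : ℂ → ℂ} {c : ℂ} {p : ℝ} (hp : 0 < p)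
    (hf : DifferentiableOn ℂ f (ball c 1)) :
    ENNReal.ofReal (π * ‖f c‖ ^ p) ≤ ∫⁻ z in ball c 1, ENNReal.ofReal (‖f z‖ ^ p) := by
  have hcont : ContinuousOn (fun z => ‖f z‖ ^ p) (ball c 1) :=
    hf.continuousOn.norm.rpow_const fun _ _ => Or.inr hp.le
  have hpolar (q : ℝ × ℝ) : c + Complex.polarCoord.symm q = circleMap c q.1 q.2 := by
    rw [Complex.polarCoord_symm_apply, circleMap, Complex.exp_mul_I]
    push_cast
    rfl
  set F : ℂ → ENNReal := (ball c 1).indicator fun z => ENNReal.ofReal (‖f z‖ ^ p) with hF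
  have hFm : Measurable F := by
    classical
    have h0 : ContinuousOn (fun z => ENNReal.ofReal (‖f z‖ ^ p)) (ball c 1) :=
      ENNReal.continuous_ofReal.comp_continuousOn hcont
    rw [hF, ← Set.piecewise_eq_indicator]
    exact h0.measurable_piecewise continuousOn_const measurableSet_ball
  have hcirc : ∀ r ∈ Ioo (0 : ℝ) 1, ENNReal.ofReal (2 * π * ‖f c‖ ^ p) ≤
      ∫⁻ θ in Ioo (-π) π, F (circleMap c r θ) := by
    intro r hr
    have hsub : closedBall c r ⊆ ball c 1 := closedBall_subset_ball hr.2
    have h1 := rpow_norm_le_circleAverage hr.1 hp (f := f) (c := c)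
      (fun z hz => hf.analyticAt (isOpen_ball.mem_nhds (hsub hz)))
    have hmem (θ : ℝ) : circleMap c r θ ∈ ball c 1 :=
      hsub (circleMap_mem_closedBall c hr.1.le θ)
    have hc : Continuous fun θ : ℝ => ‖f (circleMap c r θ)‖ ^ p := by
      exact hcont.comp_continuous (continuous_circleMap c r) hmem
    have hper : Function.Periodic (fun θ : ℝ => ‖f (circleMap c r θ)‖ ^ p) (2 * π) := by
      intro θ; simp only [periodic_circleMap c r θ]
    have h2 : 2 * π * ‖f c‖ ^ p ≤ ∫ θ in Ioo (-π) π, ‖f (circleMap c r θ)‖ ^ p := by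
      rw [circleAverage, smul_eq_mul] at h1
      have h3 := hper.intervalIntegral_add_eq 0 (-π)
      rw [zero_add, show -π + 2 * π = π by ring] at h3
      rw [h3, intervalIntegral.integral_of_le (by linarith [pi_pos]),
        integral_Ioc_eq_integral_Ioo, inv_mul_eq_div, le_div_iff₀ (by positivity)] at h1
      linarith
    refine (ENNReal.ofReal_le_ofReal h2).trans ?_
    rw [ofReal_integral_eq_lintegral_ofReal
      (hc.integrableOn_Icc.mono_set Ioo_subset_Icc_self)
      (Eventually.of_forall fun θ => by positivity)]
    refine lintegral_mono fun θ => ?_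
    rw [hF, indicator_of_mem (hmem θ)]
  have hlin : ∫⁻ z in ball c 1, ENNReal.ofReal (‖f z‖ ^ p) = ∫⁻ z, F (c + z) := by
    rw [lintegral_add_left_eq_self, hF, lintegral_indicator measurableSet_ball]
  have hmeas : Measurable fun q : ℝ × ℝ => ENNReal.ofReal q.1 * F (circleMap c q.1 q.2) := by
    refine (ENNReal.measurable_ofReal.comp measurable_fst).mul (hFm.comp ?_)
    have : Continuous fun q : ℝ × ℝ => circleMap c q.1 q.2 := by
      unfold circleMap; fun_prop
    exact this.measurable
  rw [hlin, ← Complex.lintegral_comp_polarCoord_symm, polarCoord_target]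
  simp only [hpolar, smul_eq_mul]
  rw [Measure.volume_eq_prod, ← Measure.prod_restrict, lintegral_prod _ hmeas.aemeasurable]
  have hinner (r : ℝ) : ∫⁻ θ in Ioo (-π) π, ENNReal.ofReal r * F (circleMap c r θ) =
      ENNReal.ofReal r * ∫⁻ θ in Ioo (-π) π, F (circleMap c r θ) :=
    lintegral_const_mul _ (hFm.comp (continuous_circleMap c r).measurable)
  simp only [hinner]
  calc ENNReal.ofReal (π * ‖f c‖ ^ p)
      = ∫⁻ r in Ioo (0 : ℝ) 1, ENNReal.ofReal (r * (2 * π * ‖f c‖ ^ p)) := by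
        rw [← ofReal_integral_eq_lintegral_ofReal]
        · congr 1
          rw [integral_mul_const, ← integral_Ioc_eq_integral_Ioo,
            ← intervalIntegral.integral_of_le zero_le_one, integral_id]
          ring
        · exact (Continuous.integrableOn_Icc (by fun_prop)).mono_set Ioo_subset_Icc_self
        · filter_upwards [ae_restrict_mem measurableSet_Ioo] with r hr
          have := hr.1
          positivity
    _ ≤ ∫⁻ r in Ioo (0 : ℝ) 1,
        ENNReal.ofReal r * ∫⁻ θ in Ioo (-π) π, F (circleMap c r θ) := by
        refine setLIntegral_mono' measurableSet_Ioo fun r hr => ?_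
        rw [ENNReal.ofReal_mul hr.1.le]
        gcongr
        exact hcirc r hr
    _ ≤ _ := lintegral_mono_set fun r hr => hr.1

/-- Hartogs' lemma on sequences of holomorphic functions with locally bounded roots. -/
lemma eventually_norm_le_pow_of_tendsto_root {a : ℕ → ℂ → ℂ} {R K ε : ℝ} (hε : 0 < ε) (hK : 0 ≤ K)
    (ha : ∀ m, DifferentiableOn ℂ (a m) (ball 0 (R + 1)))
    (hbd : ∀ m, 1 ≤ m → ∀ z ∈ ball (0 : ℂ) (R + 1), ‖a m z‖ ≤ K ^ m)
    (hpt : ∀ z ∈ ball (0 : ℂ) (R + 1),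
      Tendsto (fun m : ℕ => ‖a m z‖ ^ ((m : ℝ)⁻¹)) atTop (𝓝 0)) :
    ∀ᶠ m in atTop, ∀ z ∈ ball (0 : ℂ) R, ‖a m z‖ ≤ ε ^ m := by
  have hlim : Tendsto (fun m : ℕ => ∫⁻ z in ball (0 : ℂ) (R + 1),
      ENNReal.ofReal (‖a m z‖ ^ ((m : ℝ)⁻¹))) atTop
      (𝓝 (∫⁻ _ in ball (0 : ℂ) (R + 1), 0)) := by
    refine tendsto_lintegral_of_dominated_convergence' (fun _ => ENNReal.ofReal (max K 1))
      ?_ ?_ ?_ ?_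
    · intro m
      have : ContinuousOn (fun z => ENNReal.ofReal (‖a m z‖ ^ ((m : ℝ)⁻¹))) (ball 0 (R + 1)) :=
        ENNReal.continuous_ofReal.comp_continuousOn
          ((ha m).continuousOn.norm.rpow_const fun _ _ => Or.inr (by positivity))
      exact this.aemeasurable measurableSet_ball
    · intro m
      filter_upwards [ae_restrict_mem measurableSet_ball] with z hz
      refine ENNReal.ofReal_le_ofReal ?_
      rcases Nat.eq_zero_or_pos m with rfl | hm
      · simp
      refine le_trans ?_ (le_max_left K 1)
      calc ‖a m z‖ ^ ((m : ℝ)⁻¹) ≤ (K ^ m) ^ ((m : ℝ)⁻¹) :=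
            rpow_le_rpow (norm_nonneg _) (hbd m hm z hz) (by positivity)
        _ = K := pow_rpow_inv_natCast hK (by omega)
    · rw [lintegral_const, Measure.restrict_apply_univ]
      exact ENNReal.mul_ne_top ENNReal.ofReal_ne_top measure_ball_lt_top.ne
    · filter_upwards [ae_restrict_mem measurableSet_ball] with z hz
      have := (ENNReal.continuous_ofReal.tendsto 0).comp (hpt z hz)
      simpa using! this
  rw [lintegral_zero] at hlim
  have hpos : (0 : ENNReal) < ENNReal.ofReal (π * ε) := ENNReal.ofReal_pos.2 (by positivity)
  filter_upwards [hlim.eventually (gt_mem_nhds hpos), eventually_ge_atTop 1] with m hm hm1 z hz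
  have hsub : ball z 1 ⊆ ball (0 : ℂ) (R + 1) := by
    apply ball_subset_ball'
    rw [mem_ball] at hz; linarith
  have hm0 : (0 : ℝ) < (m : ℝ)⁻¹ := by positivity
  have h1 := (rpow_norm_le_lintegral_ball hm0 ((ha m).mono hsub)).trans
    (lintegral_mono_set hsub)
  have h2 := (ENNReal.ofReal_lt_ofReal_iff (by positivity)).1 (h1.trans_lt hm)
  have h3 : ‖a m z‖ ^ ((m : ℝ)⁻¹) ≤ ε := (lt_of_mul_lt_mul_left h2 pi_pos.le).le
  calc ‖a m z‖ = (‖a m z‖ ^ ((m : ℝ)⁻¹)) ^ m :=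
        (rpow_inv_natCast_pow (norm_nonneg _) (by omega)).symm
    _ ≤ ε ^ m := by gcongr

/-- The Taylor coefficients at the origin. -/
noncomputable def taylorCoeff (k : ℕ) (h : ℂ → ℂ) : ℂ := (k.factorial : ℂ)⁻¹ * iteratedDeriv k h 0

lemma hasSum_taylorCoeff {h : ℂ → ℂ} (hh : Differentiable ℂ h) (z : ℂ) :
    HasSum (fun k => taylorCoeff k h * z ^ k) (h z) := by
  have := Complex.hasSum_taylorSeries_of_entire hh 0 z
  refine this.congr_fun fun k => ?_
  simp only [taylorCoeff, smul_eq_mul, sub_zero]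
  ring

lemma norm_taylorCoeff_le {h : ℂ → ℂ} {r M : ℝ} (hr : 0 < r) (hh : DifferentiableOn ℂ h (ball 0 r))
    (hM : ∀ z ∈ ball (0 : ℂ) r, ‖h z‖ ≤ M) (k : ℕ) : ‖taylorCoeff k h‖ ≤ M / (r / 2) ^ k := by
  have hr2 : 0 < r / 2 := by positivity
  have hsub : closedBall (0 : ℂ) (r / 2) ⊆ ball 0 r := closedBall_subset_ball (by linarith)
  have := Complex.norm_iteratedDeriv_le_of_forall_mem_sphere_norm_le k hr2
    (DifferentiableOn.diffContOnCl (f := h) (by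
      rw [closure_ball _ hr2.ne']; exact hh.mono hsub))
    (fun z hz => hM z (hsub (sphere_subset_closedBall hz)))
  rw [taylorCoeff, norm_mul, norm_inv, Complex.norm_natCast]
  have hk : (0 : ℝ) < k.factorial := by positivity
  rw [inv_mul_le_iff₀ hk]
  calc _ ≤ _ := this
    _ = _ := by ring

lemma tendsto_norm_taylorCoeff_root {h : ℂ → ℂ} (hh : Differentiable ℂ h) :
    Tendsto (fun m : ℕ => ‖taylorCoeff m h‖ ^ ((m : ℝ)⁻¹)) atTop (𝓝 0) := by
  refine tendsto_order.2 ⟨fun a ha => Eventually.of_forall fun m => ha.trans_le (by positivity),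
    fun ε hε => ?_⟩
  have h1 := (hasSum_taylorCoeff hh ((2 / ε : ℝ) : ℂ)).summable.tendsto_atTop_zero.norm
  rw [norm_zero] at h1
  filter_upwards [h1.eventually (gt_mem_nhds one_pos), eventually_ge_atTop 1] with m hm hm1
  rw [norm_mul, norm_pow, Complex.norm_real, norm_of_nonneg (by positivity), div_pow,
    mul_div_assoc', div_lt_one (by positivity)] at hm
  have h2 : ‖taylorCoeff m h‖ ≤ (ε / 2) ^ m := by
    rw [div_pow, le_div_iff₀ (by positivity)]
    exact hm.le
  calc ‖taylorCoeff m h‖ ^ ((m : ℝ)⁻¹) ≤ ((ε / 2) ^ m) ^ ((m : ℝ)⁻¹) :=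
        rpow_le_rpow (norm_nonneg _) h2 (by positivity)
    _ = ε / 2 := pow_rpow_inv_natCast (by positivity) (by omega)
    _ < ε := by linarith

/-- A function on `E` that is entire along every entire curve. -/
def CurveHol (g : E → ℂ) : Prop :=
  ∀ c : ℂ → E, Differentiable ℂ c → Differentiable ℂ (g ∘ c)

lemma CurveHol.lineDifferentiableAt {g : E → ℂ} (hg : CurveHol g) (x v : E) :
    LineDifferentiableAt ℂ g x v :=
  hg (fun t => x + t • v) (by fun_prop) 0

/-- A curve-holomorphic function of two variables is bounded on some product of discs with
prescribed first factor. -/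
lemma CurveHol.exists_bound_prod {G : ℂ × ℂ → ℂ} (hG : CurveHol G) (R : ℝ) :
    ∃ w₀ : ℂ, ∃ r > 0, ∃ M : ℝ, ∀ z ∈ ball (0 : ℂ) R, ∀ w ∈ ball w₀ r, ‖G (z, w)‖ ≤ M := by
  set A : ℕ → Set ℂ := fun M => {w | ∀ z ∈ closedBall (0 : ℂ) R, ‖G (z, w)‖ ≤ M} with hA
  have hcl (M : ℕ) : IsClosed (A M) := by
    simp only [hA, ofPred_forall]
    refine isClosed_biInter fun z _ => isClosed_le ?_ continuous_const
    exact (hG (fun w => (z, w)) (by fun_prop)).continuous.norm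
  have hun : ⋃ M, A M = univ := by
    refine eq_univ_of_forall fun w => mem_iUnion.2 ?_
    obtain ⟨M, hM⟩ := (isCompact_closedBall (0 : ℂ) R).exists_bound_of_continuousOn
      (hG (fun z => (z, w)) (by fun_prop)).continuous.continuousOn
    obtain ⟨n, hn⟩ := exists_nat_ge M
    exact ⟨n, fun z hz => (hM z hz).trans hn⟩
  obtain ⟨M, w₀, hw₀⟩ := nonempty_interior_of_iUnion_of_closed hcl hun
  obtain ⟨r, hr, hsub⟩ := Metric.isOpen_iff.1 isOpen_interior w₀ hw₀
  exact ⟨w₀, r, hr, M, fun z hz w hw => interior_subset (hsub hw) z (ball_subset_closedBall hz)⟩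

lemma CurveHol.exists_bound_ball {G : ℂ × ℂ → ℂ} (hG : CurveHol G) (R : ℝ) :
    ∃ M : ℝ, ∀ z ∈ ball (0 : ℂ) R, ∀ w ∈ ball (0 : ℂ) R, ‖G (z, w)‖ ≤ M := by
  rcases le_or_gt R 0 with hR | hR
  · exact ⟨0, fun z hz => by simp [ball_eq_empty.2 hR] at hz⟩
  obtain ⟨w₀, r, hr, M, hM⟩ := hG.exists_bound_prod (R + 1)
  set U : Set (ℂ × ℂ) := ball 0 (R + 1) ×ˢ ball w₀ r with hU
  have hUo : IsOpen U := isOpen_ball.prod isOpen_ball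
  have hGU : GateauxHol U G := by
    refine ⟨fun x _ v => hG.lineDifferentiableAt x v, fun x hx => ⟨M, ?_⟩⟩
    filter_upwards [hUo.mem_nhds hx] with y hy
    exact hM y.1 hy.1 y.2 hy.2
  have hw₀ : w₀ ∈ ball w₀ r := mem_ball_self hr
  have hM0 : 0 ≤ M := (norm_nonneg _).trans (hM 0 (mem_ball_self (by linarith)) w₀ hw₀)
  have hent (z : ℂ) : Differentiable ℂ fun t => G (z, w₀ + t) :=
    hG (fun t => (z, w₀ + t)) (by fun_prop)
  set a : ℕ → ℂ → ℂ := fun m z => taylorCoeff m fun t => G (z, w₀ + t) with ha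
  have ha' (m : ℕ) (z : ℂ) :
      a m z = (m.factorial : ℂ)⁻¹ * iterLineDeriv G m (fun _ => ((0, 1) : ℂ × ℂ)) (z, w₀) := by
    have := iterLineDeriv_const G m ((z, w₀) : ℂ × ℂ) (0, 1) 0
    simp only [zero_smul, add_zero] at this
    rw [this]
    simp [ha, taylorCoeff]
  set K : ℝ := (M + 1) * (1 + 2 / r) with hK
  have hK0 : 0 ≤ K := by positivity
  have had (m : ℕ) : DifferentiableOn ℂ (a m) (ball 0 (R + 1)) := by
    intro z hz
    have h1 := (hGU.iterLineDeriv hUo m fun _ => ((0, 1) : ℂ × ℂ)).analyticAt hUo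
      (x := (z, w₀)) ⟨hz, hw₀⟩
    have h2 : DifferentiableAt ℂ
        (fun z => iterLineDeriv G m (fun _ => ((0, 1) : ℂ × ℂ)) (z, w₀)) z :=
      h1.differentiableAt.comp z (f := fun z => ((z, w₀) : ℂ × ℂ)) (by fun_prop)
    rw [show a m = _ from funext (ha' m)]
    exact (h2.const_mul _).differentiableWithinAt
  have habd (m : ℕ) (z : ℂ) (hz : z ∈ ball (0 : ℂ) (R + 1)) : ‖a m z‖ ≤ M / (r / 2) ^ m := by
    refine norm_taylorCoeff_le hr (hent z).differentiableOn (fun t ht => hM z hz _ ?_) m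
    simpa using ht
  have hbd (m : ℕ) (hm : 1 ≤ m) (z : ℂ) (hz : z ∈ ball (0 : ℂ) (R + 1)) : ‖a m z‖ ≤ K ^ m := by
    refine (habd m z hz).trans ?_
    rw [hK, mul_pow, div_eq_mul_inv, ← inv_pow, inv_div]
    gcongr
    · calc M ≤ M + 1 := by linarith
        _ ≤ _ := le_self_pow₀ (by linarith) (by omega)
    · linarith
  have hroot := eventually_norm_le_pow_of_tendsto_root
    (ε := (2 * (‖w₀‖ + R))⁻¹) (by positivity) hK0 had hbd
    (fun z _ => tendsto_norm_taylorCoeff_root (hent z))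
  obtain ⟨N, hN⟩ := eventually_atTop.1 hroot
  set b : ℕ → ℝ := fun m => if m < N then M / (r / 2) ^ m * (‖w₀‖ + R) ^ m else (1 / 2) ^ m with hb
  have hbs : Summable b := by
    refine (summable_congr_atTop ?_).1 summable_geometric_two
    filter_upwards [eventually_ge_atTop N] with m hm
    simp [hb, hm.not_gt]
  refine ⟨∑' m, b m, fun z hz w hw => ?_⟩
  have hz' : z ∈ ball (0 : ℂ) (R + 1) := ball_subset_ball (by linarith) hz
  have hs := hasSum_taylorCoeff (hent z) (w - w₀)
  rw [add_sub_cancel] at hs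
  have hww : ‖w - w₀‖ ≤ ‖w₀‖ + R := by
    rw [mem_ball_zero_iff] at hw
    linarith [norm_sub_le w w₀]
  have hle (m : ℕ) : ‖a m z * (w - w₀) ^ m‖ ≤ b m := by
    rw [norm_mul, norm_pow, hb]
    dsimp only
    split_ifs with hm
    · gcongr
      exact habd m z hz'
    · calc ‖a m z‖ * ‖w - w₀‖ ^ m ≤ ((2 * (‖w₀‖ + R))⁻¹) ^ m * (‖w₀‖ + R) ^ m := by
            gcongr
            exact hN m (not_lt.1 hm) z hz
        _ = (1 / 2) ^ m := by
            rw [← mul_pow]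
            congr 1
            have : ‖w₀‖ + R ≠ 0 := by positivity
            field_simp
  rw [← hs.tsum_eq]
  exact tsum_of_norm_bounded hbs.hasSum hle

/-- Hartogs' theorem: separate holomorphy along entire curves gives joint analyticity. -/
lemma CurveHol.analyticAt_prod {G : ℂ × ℂ → ℂ} (hG : CurveHol G) (x : ℂ × ℂ) :
    AnalyticAt ℂ G x := by
  refine GateauxHol.analyticAt (U := univ) isOpen_univ
    ⟨fun x _ v => hG.lineDifferentiableAt x v, fun x _ => ?_⟩ (mem_univ x)
  obtain ⟨M, hM⟩ := hG.exists_bound_ball (‖x‖ + 1)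
  refine ⟨M, ?_⟩
  filter_upwards [isOpen_ball.mem_nhds (show x ∈ ball 0 (‖x‖ + 1) by simp)] with y hy
  rw [mem_ball_zero_iff] at hy
  exact hM _ (mem_ball_zero_iff.2 ((norm_fst_le y).trans_lt hy)) _
    (mem_ball_zero_iff.2 ((norm_snd_le y).trans_lt hy))

lemma taylorCoeff_eq_of_hasSum {h : ℂ → ℂ} {b : ℕ → ℂ} (hh : Differentiable ℂ h)
    (hb : ∀ z, HasSum (fun k => b k * z ^ k) (h z)) (k : ℕ) : taylorCoeff k h = b k := by
  have key (a : ℕ → ℂ) (ha : ∀ z, HasSum (fun k => a k * z ^ k) (h z)) :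
      HasFPowerSeriesAt h (FormalMultilinearSeries.ofScalars ℂ a) 0 := by
    rw [hasFPowerSeriesAt_iff]
    refine Eventually.of_forall fun z => ?_
    simpa [FormalMultilinearSeries.coeff_ofScalars, mul_comm] using ha z
  have := (key _ (hasSum_taylorCoeff hh)).eq_formalMultilinearSeries (key b hb)
  simpa [FormalMultilinearSeries.coeff_ofScalars] using
    congr_arg (FormalMultilinearSeries.coeff · k) this

lemma taylorCoeff_comp_pow {h : ℂ → ℂ} (hh : Differentiable ℂ h) {n : ℕ} (hn : 1 ≤ n) (m : ℕ) :
    taylorCoeff (m * n) (fun y => h (y ^ n)) = taylorCoeff m h := by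
  have hinj : Function.Injective fun i : ℕ => i * n := fun i j hij => Nat.eq_of_mul_eq_mul_right hn hij
  have hb := taylorCoeff_eq_of_hasSum (h := fun y => h (y ^ n))
    (b := fun k => if n ∣ k then taylorCoeff (k / n) h else 0)
    (hh.comp (differentiable_id.pow n)) (fun y => ?_) (m * n)
  · rw [hb]
    simp [Nat.mul_div_cancel m hn]
  · refine (hinj.hasSum_iff fun k hk => ?_).1 ?_
    · have : ¬ n ∣ k := fun ⟨i, hi⟩ => hk ⟨i, by rw [hi]; exact mul_comm _ _⟩
      simp [this]
    · refine (hasSum_taylorCoeff hh (y ^ n)).congr_fun fun i => ?_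
      simp [Nat.mul_div_cancel i hn, ← pow_mul, mul_comm n i]

lemma taylorCoeff_comp_const_mul {h : ℂ → ℂ} (hh : Differentiable ℂ h) (s : ℂ) (k : ℕ) :
    taylorCoeff k (fun y => h (s * y)) = s ^ k * taylorCoeff k h := by
  rw [taylorCoeff, iteratedDeriv_comp_const_mul hh.contDiff, taylorCoeff]
  simp only [mul_zero]
  ring

lemma taylorCoeff_eq_of_norm_sub_le {h₁ h₂ : ℂ → ℂ} (hh₁ : Differentiable ℂ h₁)
    (hh₂ : Differentiable ℂ h₂) {C : ℝ} {k : ℕ}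
    (hC : ∀ᶠ z in 𝓝 0, ‖h₁ z - h₂ z‖ ≤ C * ‖z‖ ^ (k + 1)) :
    taylorCoeff k h₁ = taylorCoeff k h₂ := by
  have hsub : taylorCoeff k (fun z => h₁ z - h₂ z) = taylorCoeff k h₁ - taylorCoeff k h₂ := by
    rw [taylorCoeff, iteratedDeriv_fun_sub hh₁.contDiff.contDiffAt hh₂.contDiff.contDiffAt,
      mul_sub, taylorCoeff, taylorCoeff]
  rw [← sub_eq_zero, ← hsub, ← norm_le_zero_iff]
  obtain ⟨ρ, hρ, hb⟩ := Metric.eventually_nhds_iff_ball.1 hC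
  have hlim : Tendsto (fun r : ℝ => |C| * 2 ^ k * r) (𝓝[>] 0) (𝓝 0) := by
    have : Tendsto (fun r : ℝ => |C| * 2 ^ k * r) (𝓝 0) (𝓝 (|C| * 2 ^ k * 0)) :=
      tendsto_id.const_mul _
    rw [mul_zero] at this
    exact this.mono_left nhdsWithin_le_nhds
  refine ge_of_tendsto hlim ?_
  filter_upwards [Ioo_mem_nhdsGT hρ] with r hr
  have hr0 : 0 < r := hr.1
  calc _ ≤ |C| * r ^ (k + 1) / (r / 2) ^ k :=
        norm_taylorCoeff_le hr0 (hh₁.sub hh₂).differentiableOn (fun z hz => ?_) k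
    _ = |C| * 2 ^ k * r := by
        rw [div_pow, pow_succ]; field_simp
  refine (hb z (ball_subset_ball hr.2.le hz)).trans ?_
  rw [mem_ball_zero_iff] at hz
  gcongr
  exact le_abs_self C

namespace CurveHol

lemma comp {F : Type*} [NormedAddCommGroup F] [NormedSpace ℂ F] {g : E → ℂ} (hg : CurveHol g)
    {φ : F → E} (hφ : Differentiable ℂ φ) : CurveHol (g ∘ φ) :=
  fun c hc => hg (φ ∘ c) (hφ.comp hc)

lemma differentiable_taylorCoeff {G : ℂ × ℂ → ℂ} (hG : CurveHol G) (k : ℕ) :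
    Differentiable ℂ fun s => taylorCoeff k fun y => G (s, y) := by
  have hU : GateauxHol univ G := ⟨fun x _ v => hG.lineDifferentiableAt x v, fun x _ =>
    ⟨_, (hG.analyticAt_prod x).continuousAt.norm.eventually (ge_mem_nhds (lt_add_one ‖G x‖))⟩⟩
  have h (s : ℂ) : (taylorCoeff k fun y => G (s, y)) =
      (k.factorial : ℂ)⁻¹ * iterLineDeriv G k (fun _ => ((0, 1) : ℂ × ℂ)) (s, 0) := by
    have := iterLineDeriv_const G k ((s, 0) : ℂ × ℂ) (0, 1) 0
    simp only [zero_smul, add_zero] at this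
    rw [this]
    simp [taylorCoeff]
  simp only [h]
  intro s
  have h1 := (hU.iterLineDeriv isOpen_univ k fun _ => ((0, 1) : ℂ × ℂ)).analyticAt isOpen_univ
    (mem_univ (s, 0))
  exact (h1.differentiableAt.comp s (f := fun s => ((s, 0) : ℂ × ℂ)) (by fun_prop)).const_mul _

/-- The Taylor coefficients of `f ∘ γ` depend only on the jet of `γ`. -/
lemma taylorCoeff_add_pow_smul {f : E → ℂ} (hf : CurveHol f) {q η : ℂ → E}
    (hq : Differentiable ℂ q) (hη : Differentiable ℂ η) (k : ℕ) :
    taylorCoeff k (fun z => f (q z + z ^ (k + 1) • η z)) = taylorCoeff k (fun z => f (q z)) := by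
  have hΦ : CurveHol fun p : ℂ × ℂ => f (q p.1 + p.2 • η p.1) :=
    hf.comp (φ := fun p : ℂ × ℂ => q p.1 + p.2 • η p.1) (by fun_prop)
  obtain ⟨C, t, ht, hL⟩ :=
    ((hΦ.analyticAt_prod (0, 0)).contDiffAt (n := 1)).exists_lipschitzOnWith
  refine taylorCoeff_eq_of_norm_sub_le (C := C)
    (hf (fun z => q z + z ^ (k + 1) • η z) (by fun_prop)) (hf q hq) ?_
  have h1 : Tendsto (fun z : ℂ => (z, z ^ (k + 1))) (𝓝 0) (𝓝 (0, 0)) := by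
    have : Continuous fun z : ℂ => (z, z ^ (k + 1)) := by fun_prop
    simpa using this.tendsto 0
  have h2 : Tendsto (fun z : ℂ => (z, (0 : ℂ))) (𝓝 0) (𝓝 (0, 0)) := by
    have : Continuous fun z : ℂ => (z, (0 : ℂ)) := by fun_prop
    simpa using this.tendsto 0
  filter_upwards [h1 ht, h2 ht] with z hz1 hz2
  simpa [dist_eq_norm, Prod.norm_def] using hL.dist_le_mul _ hz1 _ hz2

lemma exists_taylorCoeff_add_pow_smul {f : E → ℂ} (hf : CurveHol f) {q : ℂ → E}
    (hq : Differentiable ℂ q) (hq0 : q 0 = 0) {n m : ℕ} (hn : 1 ≤ n) {v : E}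
    (hv : 1 < ‖taylorCoeff m fun z => f (z • v)‖) :
    ∃ v' : E, ‖v'‖ = ‖v‖ ∧ 1 < ‖taylorCoeff (m * n) fun z => f (q z + z ^ n • v')‖ := by
  have hΦ : CurveHol fun p : ℂ × ℂ => f (q (p.1 * p.2) + p.2 ^ n • v) :=
    hf.comp (φ := fun p : ℂ × ℂ => q (p.1 * p.2) + p.2 ^ n • v) (by fun_prop)
  set A : ℂ → ℂ := fun s => taylorCoeff (m * n) fun y => f (q (s * y) + y ^ n • v) with hA
  have hAd : Differentiable ℂ A := hΦ.differentiable_taylorCoeff (m * n)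
  have hA0 : A 0 = taylorCoeff m fun z => f (z • v) := by
    rw [← taylorCoeff_comp_pow (h := fun z => f (z • v)) (hf (fun z => z • v) (by fun_prop)) hn]
    simp [hA, hq0]
  obtain ⟨s, hs, hs1⟩ : ∃ s ∈ sphere (0 : ℂ) 1, 1 < ‖A s‖ := by
    by_contra! hcon
    rw [← hA0] at hv
    refine hv.not_ge (Complex.norm_le_of_forall_mem_frontier_norm_le isBounded_ball
      (hAd.diffContOnCl (s := ball 0 1)) (fun z hz => hcon z ?_)
      (subset_closure (mem_ball_self one_pos)))
    rwa [frontier_ball _ one_ne_zero] at hz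
  rw [mem_sphere_zero_iff_norm] at hs
  have hs0 : s ≠ 0 := norm_ne_zero_iff.1 (by rw [hs]; exact one_ne_zero)
  refine ⟨(s ^ n)⁻¹ • v, by simp [norm_smul, hs], ?_⟩
  have hd : Differentiable ℂ fun z => f (q z + z ^ n • (s ^ n)⁻¹ • v) :=
    hf (fun z => q z + z ^ n • (s ^ n)⁻¹ • v) (by fun_prop)
  have hAs : A s = s ^ (m * n) * taylorCoeff (m * n) fun z => f (q z + z ^ n • (s ^ n)⁻¹ • v) := by
    rw [← taylorCoeff_comp_const_mul hd]
    simp only [hA, smul_smul, mul_pow]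
    congr! 6 with y
    field_simp
  rwa [hAs, norm_mul, norm_pow, hs, one_pow, one_mul] at hs1

end CurveHol

lemma summable_and_differentiable_tsum_pow_smul [CompleteSpace E] {v : ℕ → E} {e n : ℕ → ℕ}
    (hn : Function.Injective n) (he : ∀ j, e j ≤ n j)
    (hv : ∀ j, ‖v j‖ ≤ ((n j).factorial : ℝ)⁻¹) :
    (∀ z : ℂ, Summable fun j => z ^ e j • v j) ∧
      Differentiable ℂ fun z : ℂ => ∑' j, z ^ e j • v j := by
  have hsum (R : ℝ) : Summable fun j => R ^ n j / (n j).factorial :=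
    (Real.summable_pow_div_factorial R).comp_injective hn
  have hle (R : ℝ) (hR : 1 ≤ R) (z : ℂ) (hz : ‖z‖ ≤ R) (j : ℕ) :
      ‖z ^ e j • v j‖ ≤ R ^ n j / (n j).factorial := by
    rw [norm_smul, norm_pow, div_eq_mul_inv]
    gcongr
    · calc ‖z‖ ^ e j ≤ R ^ e j := by gcongr
        _ ≤ R ^ n j := pow_le_pow_right₀ hR (he j)
    · exact hv j
  refine ⟨fun z => (hsum (‖z‖ + 1)).of_norm_bounded
    (hle (‖z‖ + 1) (by linarith [norm_nonneg z]) z (by linarith)), fun z => ?_⟩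
  have := Complex.differentiableOn_tsum_of_summable_norm (hsum (‖z‖ + 1))
    (F := fun j (z : ℂ) => z ^ e j • v j)
    (fun j => by fun_prop) (isOpen_ball (x := (0 : ℂ)) (ε := ‖z‖ + 1))
    (fun j w hw => hle (‖z‖ + 1) (by linarith [norm_nonneg z]) w
      (mem_ball_zero_iff.1 hw).le j)
  exact this.differentiableAt (isOpen_ball.mem_nhds (by simp))

namespace CurveHol

lemma exists_forall_norm_taylorCoeff_le [CompleteSpace E] {f : E → ℂ} (hf : CurveHol f) :
    ∃ ε > 0, ∀ v : E, ‖v‖ ≤ ε → ∀ m, 1 ≤ m → ‖taylorCoeff m fun z => f (z • v)‖ ≤ 1 := by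
  by_contra! hcon
  have hstep (n : ℕ) (q : ℂ → E) (hn : 1 ≤ n) (hq : Differentiable ℂ q) (hq0 : q 0 = 0) :
      ∃ (v : E) (k : ℕ), ‖v‖ ≤ (n.factorial : ℝ)⁻¹ ∧ n ≤ k ∧
        1 < ‖taylorCoeff k fun z => f (q z + z ^ n • v)‖ := by
    obtain ⟨v, hv, m, hm, hvm⟩ := hcon (n.factorial : ℝ)⁻¹ (by positivity)
    obtain ⟨v', hv', h⟩ := hf.exists_taylorCoeff_add_pow_smul hq hq0 hn hvm
    exact ⟨v', m * n, hv'.trans_le hv, Nat.le_mul_of_pos_left n hm, h⟩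
  choose! V κ hV hκ hlarge using hstep
  set s : ℕ → ℕ × (ℂ → E) := fun j => Nat.rec (1, fun _ => 0)
    (fun _ p => (κ p.1 p.2 + 1, fun z => p.2 z + z ^ p.1 • V p.1 p.2)) j with hs
  have hs_succ (j : ℕ) : s (j + 1) = (κ (s j).1 (s j).2 + 1,
    fun z => (s j).2 z + z ^ (s j).1 • V (s j).1 (s j).2) := rfl
  have hinv (j : ℕ) : 1 ≤ (s j).1 ∧ Differentiable ℂ (s j).2 ∧ (s j).2 0 = 0 := by
    induction j with
    | zero => exact ⟨le_rfl, differentiable_const _, rfl⟩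
    | succ j ih =>
      obtain ⟨h1, h2, h3⟩ := ih
      rw [hs_succ]
      refine ⟨by simp, by fun_prop, ?_⟩
      simp [h3, (show (s j).1 ≠ 0 by omega)]
  set n : ℕ → ℕ := fun j => (s j).1 with hn
  set v : ℕ → E := fun j => V (s j).1 (s j).2 with hv
  set k : ℕ → ℕ := fun j => κ (s j).1 (s j).2 with hk
  have hnk (j : ℕ) : n j ≤ k j := hκ _ _ (hinv j).1 (hinv j).2.1 (hinv j).2.2
  have hn_succ (j : ℕ) : n (j + 1) = k j + 1 := rfl
  have hmono : StrictMono n := strictMono_nat_of_lt_succ fun j => by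
    rw [hn_succ]; exact Nat.lt_succ_of_le (hnk j)
  have hvn (j : ℕ) : ‖v j‖ ≤ ((n j).factorial : ℝ)⁻¹ :=
    hV _ _ (hinv j).1 (hinv j).2.1 (hinv j).2.2
  have hpartial (J : ℕ) (z : ℂ) : (s J).2 z = ∑ j ∈ Finset.range J, z ^ n j • v j := by
    induction J with
    | zero => rfl
    | succ J ih => rw [Finset.sum_range_succ, ← ih, hs_succ]
  obtain ⟨hγs, hγd⟩ := summable_and_differentiable_tsum_pow_smul hmono.injective
    (fun j => le_rfl) hvn
  have hcoeff (J : ℕ) : 1 < ‖taylorCoeff (k J) fun z => f (∑' j, z ^ n j • v j)‖ := by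
    obtain ⟨-, hηd⟩ := summable_and_differentiable_tsum_pow_smul
      (v := fun j => v (j + (J + 1))) (n := fun j => n (j + (J + 1)))
      (e := fun j => n (j + (J + 1)) - n (J + 1))
      (hmono.injective.comp (add_left_injective (J + 1))) (fun j => Nat.sub_le _ _)
      (fun j => hvn (j + (J + 1)))
    have hsplit (z : ℂ) : ∑' j, z ^ n j • v j = (s (J + 1)).2 z +
        z ^ (k J + 1) • ∑' j, z ^ (n (j + (J + 1)) - n (J + 1)) • v (j + (J + 1)) := by
      rw [← (hγs z).sum_add_tsum_nat_add (J + 1), ← tsum_const_smul'', ← hn_succ]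
      refine congrArg₂ (· + ·) (hpartial (J + 1) z).symm (tsum_congr fun j => ?_)
      have hle : n (J + 1) ≤ n (j + (J + 1)) := hmono.monotone (Nat.le_add_left (J + 1) j)
      rw [smul_smul, ← pow_add, Nat.add_sub_cancel' hle]
    simp only [hsplit]
    rw [hf.taylorCoeff_add_pow_smul (hinv (J + 1)).2.1 hηd]
    exact hlarge _ _ (hinv J).1 (hinv J).2.1 (hinv J).2.2
  have hlim := (hasSum_taylorCoeff (hf _ hγd) 1).summable.tendsto_atTop_zero.norm
  simp only [one_pow, mul_one, norm_zero] at hlim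
  obtain ⟨N, hN⟩ := eventually_atTop.1 (hlim.eventually (gt_mem_nhds one_pos))
  exact (hN (k N) ((hmono.id_le N).trans (hnk N))).not_gt (hcoeff N)

lemma eventually_norm_le_zero [CompleteSpace E] {f : E → ℂ} (hf : CurveHol f) :
    ∃ M, ∀ᶠ y in 𝓝 0, ‖f y‖ ≤ M := by
  obtain ⟨ε, hε, hle⟩ := hf.exists_forall_norm_taylorCoeff_le
  refine ⟨(‖f 0‖ + 1) * 2, ?_⟩
  filter_upwards [ball_mem_nhds (0 : E) (half_pos hε)] with y hy
  rw [mem_ball_zero_iff] at hy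
  have h2 : ‖(2 : ℂ) • y‖ ≤ ε := by
    rw [norm_smul, Complex.norm_ofNat]; linarith
  have hs := hasSum_taylorCoeff (hf (fun z => z • (2 : ℂ) • y) (by fun_prop)) (1 / 2)
  have hy2 : (f ∘ fun z : ℂ => z • (2 : ℂ) • y) (1 / 2) = f y := by simp [smul_smul]
  rw [hy2] at hs
  rw [← hs.tsum_eq]
  refine tsum_of_norm_bounded (hasSum_geometric_two.mul_left (‖f 0‖ + 1)) fun m => ?_
  rw [norm_mul, norm_pow]
  have h12 : ‖(1 / 2 : ℂ)‖ = 1 / 2 := by simp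
  rw [h12]
  gcongr
  rcases Nat.eq_zero_or_pos m with rfl | hm
  · simp [taylorCoeff]
  · exact (hle _ h2 m hm).trans (by linarith [norm_nonneg (f 0)])

theorem analyticAt [CompleteSpace E] {f : E → ℂ} (hf : CurveHol f) (x : E) : AnalyticAt ℂ f x := by
  refine GateauxHol.analyticAt (U := univ) isOpen_univ
    ⟨fun x _ v => hf.lineDifferentiableAt x v, fun x _ => ?_⟩ (mem_univ x)
  obtain ⟨M, hM⟩ := (hf.comp (φ := fun y => x + y) (by fun_prop)).eventually_norm_le_zero
  refine ⟨M, ?_⟩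
  have : Tendsto (fun y => y - x) (𝓝 x) (𝓝 0) := by
    have h : Continuous fun y : E => y - x := by fun_prop
    simpa using h.tendsto x
  filter_upwards [this.eventually hM] with y hy
  simpa using hy

end CurveHol

end

/-- Holomorphy by curve testing (Kriegl–Michor): a function `f : E → ℂ` on a complex Banach
space is analytic on all of `E` if and only if for every curve `γ : ℂ → E` analytic on the
open unit disc, the composite `f ∘ γ` is analytic on the open unit disc. -/
theorem analytic_iff_curve_testing
    (E : Type*) [NormedAddCommGroup E] [NormedSpace ℂ E] [CompleteSpace E]
    (f : E → ℂ) :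
    (∀ x : E, AnalyticAt ℂ f x) ↔
      (∀ γ : ℂ → E, (∀ z ∈ ball (0 : ℂ) 1, AnalyticAt ℂ γ z) →
        ∀ z ∈ ball (0 : ℂ) 1, AnalyticAt ℂ (f ∘ γ) z) := by
  refine ⟨fun h γ hγ z hz => (h (γ z)).comp (hγ z hz), fun h => ?_⟩
  refine CurveHol.analyticAt fun c hc z => ?_
  set R : ℂ := ((‖z‖ + 1 : ℝ) : ℂ) with hR
  have hR0 : 0 < ‖z‖ + 1 := by positivity
  have hRne : R ≠ 0 := by rw [hR]; exact_mod_cast hR0.ne'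
  have hcR : Differentiable ℂ fun w => c (R * w) := by fun_prop
  have hz : R⁻¹ * z ∈ ball (0 : ℂ) 1 := by
    rw [mem_ball_zero_iff, norm_mul, norm_inv, hR, Complex.norm_real, Real.norm_of_nonneg hR0.le,
      inv_mul_lt_one₀ hR0]
    linarith
  have h1 := (h _ (fun w _ => hcR.analyticAt w) _ hz).differentiableAt
  have h2 := h1.comp z (f := fun w => R⁻¹ * w) (by fun_prop)
  refine h2.congr_of_eventuallyEq (Filter.Eventually.of_forall fun w => ?_)
  simp [mul_inv_cancel_left₀ hRne]
end

section
/- Let n ≥ 1, m ∈ ℕ, and let φ : ℝ^n → ℂ be a smooth (C^∞) function. For Re(s) > (m+1)/2 the integral I(s) = ∫_{[0,1]^n} (t_1 ⋯ t_n)^{2s−2} · t_n^{−m} · φ(t_1, …, t_n) dt_1 ⋯ dt_n converges and is holomorphic in s. Moreover there exists a function g : ℂ → ℂ, meromorphic on all of ℂ, such that g(s) = I(s) for Re(s) > (m+1)/2, g is analytic at every point of ℂ ∖ {(1 + m − k)/2 : k ∈ ℕ}, and at each point s₀ = (1 + m − k)/2 (k ∈ ℕ) the function g is meromorphic with a pole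 of order at most n. -/
open MeasureTheory Filter Complex

lemma ae_restrict_unitCube_mem_Ioo {ι : Type*} [Fintype ι] :
    ∀ᵐ t : ι → ℝ ∂volume.restrict (Set.univ.pi fun _ => Set.Icc (0 : ℝ) 1),
      ∀ i, t i ∈ Set.Ioo (0 : ℝ) 1 := by
  have h : (Set.univ.pi fun _ : ι => Set.Ioo (0 : ℝ) 1) =ᵐ[volume]
      Set.univ.pi fun _ : ι => Set.Icc (0 : ℝ) 1 := by
    rw [Set.pi_univ_Icc]
    exact Measure.univ_pi_Ioo_ae_eq_Icc (f := fun _ : ι => (0 : ℝ)) (g := fun _ => 1)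
  rw [← Measure.restrict_congr_set h]
  filter_upwards [ae_restrict_mem (MeasurableSet.univ_pi fun _ => measurableSet_Ioo)] with t ht i
  exact ht i (Set.mem_univ i)

lemma integrableOn_unitCube_prod_rpow {ι : Type*} [Fintype ι] (S : Finset ι) (r : ι → ℝ)
    (hr : ∀ i ∈ S, -1 < r i) :
    IntegrableOn (fun t : ι → ℝ => ∏ i ∈ S, t i ^ r i)
      (Set.univ.pi fun _ => Set.Icc (0 : ℝ) 1) := by
  classical
  have h (i : ι) : Integrable (fun x : ℝ => if i ∈ S then x ^ r i else 1)
      (volume.restrict (Set.Icc (0 : ℝ) 1)) := by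
    split_ifs with hi
    · have := intervalIntegral.intervalIntegrable_rpow' (a := 0) (b := 1) (hr i hi)
      rwa [intervalIntegrable_iff_integrableOn_Icc_of_le zero_le_one] at this
    · exact integrable_const _
  have := Integrable.fintype_prod h
  rw [IntegrableOn, volume_pi, Measure.restrict_pi_pi]
  simpa [Finset.prod_ite_mem] using this

lemma norm_prod_ofReal_cpow {ι : Type*} (S : Finset ι) (t : ι → ℝ) (z : ι → ℂ)
    (ht : ∀ i, 0 < t i) : ‖∏ i ∈ S, (t i : ℂ) ^ z i‖ = ∏ i ∈ S, t i ^ (z i).re := by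
  rw [norm_prod]
  exact Finset.prod_congr rfl fun i _ => norm_cpow_eq_rpow_re_of_pos (ht i) _

lemma exists_norm_le_unitCube {ι : Type*} [Fintype ι] {ψ : (ι → ℝ) → ℂ} (hψ : Continuous ψ) :
    ∃ C, 0 ≤ C ∧ ∀ t : ι → ℝ, (∀ i, t i ∈ Set.Ioo (0 : ℝ) 1) → ‖ψ t‖ ≤ C := by
  obtain ⟨C, hC⟩ := (isCompact_univ_pi fun _ : ι => isCompact_Icc (a := (0 : ℝ)) (b := 1))
    |>.exists_bound_of_continuousOn hψ.continuousOn
  exact ⟨max C 0, le_max_right _ _, fun t ht =>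
    (hC t fun i _ => Set.Ioo_subset_Icc_self (ht i)).trans (le_max_left _ _)⟩

lemma integrableOn_unitCube_prod_cpow_mul {ι : Type*} [Fintype ι] (S : Finset ι) (z : ι → ℂ)
    (hz : ∀ i ∈ S, -1 < (z i).re) {ψ : (ι → ℝ) → ℂ} (hψ : Continuous ψ) :
    IntegrableOn (fun t : ι → ℝ => (∏ i ∈ S, (t i : ℂ) ^ z i) * ψ t)
      (Set.univ.pi fun _ => Set.Icc (0 : ℝ) 1) := by
  obtain ⟨C, hC0, hC⟩ := exists_norm_le_unitCube hψ
  refine ((integrableOn_unitCube_prod_rpow S (fun i => (z i).re) hz).mul_const C).mono' ?_ ?_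
  · have : Measurable ψ := hψ.measurable
    exact Measurable.aestronglyMeasurable (by fun_prop)
  · filter_upwards [ae_restrict_unitCube_mem_Ioo] with t ht
    rw [norm_mul, norm_prod_ofReal_cpow S t z fun i => (ht i).1]
    have := hC t ht
    have h0 : 0 ≤ ∏ i ∈ S, t i ^ (z i).re :=
      Finset.prod_nonneg fun i _ => Real.rpow_nonneg (ht i).1.le _
    gcongr

lemma hasDerivAt_prod_ofReal_cpow_add {ι : Type*} (S : Finset ι) (t : ι → ℝ)
    (ht : ∀ i, 0 < t i) (k : ι → ℂ) (w : ℂ) :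
    HasDerivAt (fun w : ℂ => ∏ i ∈ S, (t i : ℂ) ^ (w + k i))
      ((∏ i ∈ S, (t i : ℂ) ^ (w + k i)) * ∑ i ∈ S, (Real.log (t i) : ℂ)) w := by
  have h (w : ℂ) : ∏ i ∈ S, (t i : ℂ) ^ (w + k i) =
      exp (∑ i ∈ S, (Real.log (t i) : ℂ) * (w + k i)) := by
    rw [Complex.exp_sum]
    refine Finset.prod_congr rfl fun i _ => ?_
    rw [cpow_def_of_ne_zero (by exact_mod_cast (ht i).ne'), ofReal_log (ht i).le]
  simp_rw [h]
  refine HasDerivAt.cexp (HasDerivAt.fun_sum fun i _ => ?_)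
  simpa using ((hasDerivAt_id w).add_const (k i)).const_mul (Real.log (t i) : ℂ)

lemma abs_sum_log_mul_prod_rpow_le {ι : Type*} (S : Finset ι) (t : ι → ℝ)
    (ht : ∀ i, t i ∈ Set.Ioo (0 : ℝ) 1) {ε σ : ℝ} (hε : 0 < ε) (r : ι → ℝ)
    (hr : ∀ i ∈ S, σ + ε ≤ r i) :
    (∏ i ∈ S, t i ^ r i) * |∑ i ∈ S, Real.log (t i)| ≤
      (S.card / ε) * ∏ i ∈ S, t i ^ σ := by
  classical
  have hlog : |∑ i ∈ S, Real.log (t i)| ≤ (S.card / ε) * ∏ i ∈ S, t i ^ (-ε) := by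
    refine (Finset.abs_sum_le_sum_abs _ _).trans ?_
    rw [div_mul_eq_mul_div, mul_div_assoc, ← nsmul_eq_mul]
    refine Finset.sum_le_card_nsmul _ _ _ fun i hi => ?_
    have h1 := (Real.abs_log_mul_self_rpow_lt (t i) ε (ht i).1 (ht i).2.le hε).le
    rw [abs_mul, abs_of_pos (Real.rpow_pos_of_pos (ht i).1 ε)] at h1
    have h2 : |Real.log (t i)| ≤ t i ^ (-ε) / ε := by
      rw [Real.rpow_neg (ht i).1.le, inv_eq_one_div, div_div, mul_comm, ← div_div]
      rwa [le_div_iff₀ (Real.rpow_pos_of_pos (ht i).1 ε)]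
    refine h2.trans ?_
    gcongr
    rw [← Finset.mul_prod_erase S _ hi]
    refine le_mul_of_one_le_right (Real.rpow_nonneg (ht i).1.le _) ?_
    exact Finset.one_le_prod fun j _ =>
      Real.one_le_rpow_of_pos_of_le_one_of_nonpos (ht j).1 (ht j).2.le (by linarith)
  have h0 : 0 ≤ ∏ i ∈ S, t i ^ r i := Finset.prod_nonneg fun i _ => Real.rpow_nonneg (ht i).1.le _
  refine (mul_le_mul_of_nonneg_left hlog h0).trans ?_
  rw [mul_left_comm, ← Finset.prod_mul_distrib]
  refine mul_le_mul_of_nonneg_left (Finset.prod_le_prod (fun i _ => ?_) fun i hi => ?_)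
    (by positivity)
  · exact mul_nonneg (Real.rpow_nonneg (ht i).1.le _) (Real.rpow_nonneg (ht i).1.le _)
  · rw [← Real.rpow_add (ht i).1]
    exact Real.rpow_le_rpow_of_exponent_ge (ht i).1 (ht i).2.le (by linarith [hr i hi])

/-- The Mellin-type integral of `ψ` over the unit cube, with weight `∏ i ∈ S, t i ^ (w + k i)`. -/
noncomputable def cubeMellin {ι : Type*} [Fintype ι] (S : Finset ι) (k : ι → ℕ)
    (ψ : (ι → ℝ) → ℂ) (w : ℂ) : ℂ :=
  ∫ t in Set.univ.pi fun _ : ι => Set.Icc (0 : ℝ) 1, (∏ i ∈ S, (t i : ℂ) ^ (w + k i)) * ψ t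

lemma differentiableOn_cubeMellin {ι : Type*} [Fintype ι] (S : Finset ι) (k : ι → ℕ) (N : ℕ)
    (hk : ∀ i ∈ S, N ≤ k i) {ψ : (ι → ℝ) → ℂ} (hψ : Continuous ψ) :
    DifferentiableOn ℂ (cubeMellin S k ψ) {w | -1 - (N : ℝ) < w.re} := by
  intro w₀ hw₀
  obtain ⟨C, hC0, hC⟩ := exists_norm_le_unitCube hψ
  have hψm : Measurable ψ := hψ.measurable
  set ε : ℝ := (w₀.re + 1 + N) / 3 with hε_def
  have hw₀' : -1 - (N : ℝ) < w₀.re := hw₀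
  have hε : 0 < ε := by rw [hε_def]; linarith
  have hkN (i) (hi : i ∈ S) : (N : ℝ) ≤ k i := by exact_mod_cast hk i hi
  refine (hasDerivAt_integral_of_dominated_loc_of_deriv_le (s := Metric.ball w₀ ε)
    (F := fun (w : ℂ) (t : ι → ℝ) => (∏ i ∈ S, (t i : ℂ) ^ (w + k i)) * ψ t)
    (F' := fun w t => ((∏ i ∈ S, (t i : ℂ) ^ (w + k i)) * ∑ i ∈ S, (Real.log (t i) : ℂ)) * ψ t)
    (bound := fun t => (S.card / ε) * (∏ i ∈ S, t i ^ (-1 + ε)) * C)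
    (Metric.ball_mem_nhds _ hε) ?_ ?_ ?_ ?_ ?_
    ?_).2.differentiableAt.differentiableWithinAt
  · exact Eventually.of_forall fun w => Measurable.aestronglyMeasurable (by fun_prop)
  · refine integrableOn_unitCube_prod_cpow_mul S _ (fun i hi => ?_) hψ
    simp only [add_re, natCast_re]
    linarith [hkN i hi]
  · exact Measurable.aestronglyMeasurable (by fun_prop)
  · filter_upwards [ae_restrict_unitCube_mem_Ioo] with t ht w hw
    rw [norm_mul, norm_mul, norm_prod_ofReal_cpow S t _ fun i => (ht i).1, ← ofReal_sum,
      norm_real, Real.norm_eq_abs]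
    have h1 : |(w - w₀).re| < ε := (abs_re_le_norm _).trans_lt (by simpa [dist_eq] using hw)
    rw [sub_re, abs_lt] at h1
    have := abs_sum_log_mul_prod_rpow_le S t ht hε (σ := -1 + ε) (fun i => (w + k i).re)
      fun i hi => by
        simp only [add_re, natCast_re]
        linarith [hkN i hi]
    exact mul_le_mul this (hC t ht) (norm_nonneg _) ((by
      refine mul_nonneg (by positivity)
        (Finset.prod_nonneg fun i _ => Real.rpow_nonneg (ht i).1.le _)))
  · exact ((integrableOn_unitCube_prod_rpow S _ fun i _ => by linarith).const_mul _).mul_const _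
  · filter_upwards [ae_restrict_unitCube_mem_Ioo] with t ht w hw
    exact (hasDerivAt_prod_ofReal_cpow_add S t (fun i => (ht i).1) _ w).mul_const _

lemma setIntegral_unitCube_eq_zero_of_fderiv {n : ℕ} (i : Fin n) {F D : (Fin n → ℝ) → ℂ}
    (hc : Continuous F)
    (hd : ∀ t : Fin n → ℝ, (∀ j, t j ∈ Set.Ioo (0 : ℝ) 1) → DifferentiableAt ℝ F t)
    (hD : ∀ t : Fin n → ℝ, (∀ j, t j ∈ Set.Ioo (0 : ℝ) 1) →
      fderiv ℝ F t (Pi.single i 1) = D t)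
    (hF : ∀ t : Fin n → ℝ, t i = 0 ∨ t i = 1 → F t = 0)
    (hDi : IntegrableOn D (Set.univ.pi fun _ => Set.Icc (0 : ℝ) 1)) :
    ∫ t in Set.univ.pi fun _ : Fin n => Set.Icc (0 : ℝ) 1, D t = 0 := by
  obtain _ | n := n
  · exact i.elim0
  have hsum (t : Fin (n + 1) → ℝ) : ∑ j, (if j = i then fderiv ℝ F t else 0) (Pi.single j 1) =
      fderiv ℝ F t (Pi.single i 1) := by
    rw [Finset.sum_eq_single i (fun j _ hj => by simp [hj]) (by simp), if_pos rfl]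
  have hae : D =ᵐ[volume.restrict (Set.univ.pi fun _ => Set.Icc (0 : ℝ) 1)]
      fun t => ∑ j, (if j = i then fderiv ℝ F t else 0) (Pi.single j 1) := by
    filter_upwards [ae_restrict_unitCube_mem_Ioo] with t ht
    rw [hsum, hD t ht]
  rw [integral_congr_ae hae]
  have hDi' := hDi.congr hae
  rw [Set.pi_univ_Icc] at hDi' ⊢
  rw [integral_divergence_of_hasFDerivAt_off_countable' (fun _ => (0 : ℝ)) (fun _ => 1)
    (fun _ => zero_le_one) (fun j t => if j = i then F t else 0)
    (fun j t => if j = i then fderiv ℝ F t else 0) ∅ Set.countable_empty ?_ ?_ hDi']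
  · refine Finset.sum_eq_zero fun j _ => ?_
    obtain rfl | hj := eq_or_ne j i
    · simp [hF]
    · simp [hj]
  · intro j
    split_ifs
    exacts [hc.continuousOn, continuousOn_const]
  · rintro t ⟨ht, -⟩ j
    split_ifs
    exacts [(hd t fun j => ht j (Set.mem_univ j)).hasFDerivAt, hasFDerivAt_const _ _]

lemma differentiableAt_prod_ofReal_cpow {ι : Type*} [Fintype ι] (S : Finset ι) (z : ι → ℂ)
    {t : ι → ℝ} (ht : ∀ i, 0 < t i) :
    DifferentiableAt ℝ (fun t : ι → ℝ => ∏ i ∈ S, (t i : ℂ) ^ z i) t := by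
  classical
  refine (HasFDerivAt.finsetProd fun i _ => DifferentiableAt.hasFDerivAt
    (?_ : DifferentiableAt ℝ (fun t : ι → ℝ => (t i : ℂ) ^ z i) t)).differentiableAt
  have h1 : DifferentiableAt ℝ (fun x : ℝ => (x : ℂ) ^ z i) (t i) :=
    ((hasDerivAt_id (t i : ℂ)).cpow_const (Or.inl (by simpa using ht i))
      (c := z i)).comp_ofReal.differentiableAt
  have h2 : DifferentiableAt ℝ (fun t : ι → ℝ => t i) t := by fun_prop
  exact DifferentiableAt.comp (f := fun t : ι → ℝ => t i) t h1 h2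

lemma fderiv_prod_erase_ofReal_cpow_single {ι : Type*} [Fintype ι] [DecidableEq ι] (S : Finset ι)
    (z : ι → ℂ) (i : ι) {t : ι → ℝ} (ht : ∀ i, 0 < t i) :
    fderiv ℝ (fun t : ι → ℝ => ∏ j ∈ S.erase i, (t j : ℂ) ^ z j) t (Pi.single i 1) = 0 := by
  rw [← (differentiableAt_prod_ofReal_cpow _ z ht).lineDeriv_eq_fderiv, lineDeriv]
  convert deriv_const (0 : ℝ) (∏ j ∈ S.erase i, (t j : ℂ) ^ z j) using 2
  ext x
  refine Finset.prod_congr rfl fun j hj => ?_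
  simp [Finset.ne_of_mem_erase hj]

lemma hasFDerivAt_ofReal_cpow_sub {ι : Type*} [Fintype ι] (i : ι) (c : ℂ) {t : ι → ℝ}
    (ht : 0 < t i) :
    HasFDerivAt (fun t : ι → ℝ => (t i : ℂ) ^ (c + 1) - t i)
      ((ContinuousLinearMap.proj (R := ℝ) (φ := fun _ : ι => ℝ) i).smulRight
        ((c + 1) * (t i : ℂ) ^ c - 1)) t := by
  have h1 : HasDerivAt (fun x : ℝ => (x : ℂ) ^ (c + 1) - x) ((c + 1) * (t i : ℂ) ^ c - 1) (t i) := by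
    have h := ((hasDerivAt_id (t i : ℂ)).cpow_const (Or.inl (by simpa using ht))
      (c := c + 1)).sub (hasDerivAt_id (t i : ℂ))
    simpa using h.comp_ofReal
  have h2 := h1.hasFDerivAt.comp t (hasFDerivAt_apply (𝕜 := ℝ) i t)
  refine h2.congr_fderiv ?_
  ext v
  simp

lemma continuous_prod_ofReal_cpow {ι : Type*} (S : Finset ι) (z : ι → ℂ)
    (hz : ∀ i ∈ S, 0 < (z i).re) :
    Continuous (fun t : ι → ℝ => ∏ i ∈ S, (t i : ℂ) ^ z i) :=
  continuous_finsetProd _ fun i hi =>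
    (continuous_ofReal_cpow_const (hz i hi)).comp (continuous_apply i)

lemma cubeMellin_eq_sub {n : ℕ} (S : Finset (Fin n)) (k : Fin n → ℕ) {i : Fin n} (hi : i ∈ S)
    {ψ : (Fin n → ℝ) → ℂ} (hψ : ContDiff ℝ 1 ψ) {w : ℂ} (hw : 0 < w.re) :
    (w + k i + 1) * cubeMellin S k ψ w =
      cubeMellin (S.erase i) k (fun t => ψ t + t i * fderiv ℝ ψ t (Pi.single i 1)) w -
      cubeMellin S (Function.update k i (k i + 1)) (fun t => fderiv ℝ ψ t (Pi.single i 1)) w := by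
  have hre (j : Fin n) : 0 < (w + k j).re := by
    simp only [add_re, natCast_re]; positivity
  have hψ0 := hψ.continuous
  have hψ1 : Continuous fun t => fderiv ℝ ψ t (Pi.single i 1) :=
    (hψ.continuous_fderiv one_ne_zero).clm_apply continuous_const
  have hM := continuous_prod_ofReal_cpow (S.erase i) (fun j => w + k j) fun j _ => hre j
  have hM' := continuous_prod_ofReal_cpow S (fun j => w + k j) fun j _ => hre j
  have hM'' := continuous_prod_ofReal_cpow S (fun j => w + (Function.update k i (k i + 1) j : ℕ))
    fun j _ => by simp only [add_re, natCast_re]; positivity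
  have hint {f : (Fin n → ℝ) → ℂ} (hf : Continuous f) :
      IntegrableOn f (Set.univ.pi fun _ => Set.Icc (0 : ℝ) 1) :=
    hf.continuousOn.integrableOn_compact (isCompact_univ_pi fun _ => isCompact_Icc)
  unfold cubeMellin
  rw [← sub_eq_zero, ← integral_const_mul, ← integral_sub (hint (by fun_prop)) (hint (by fun_prop)),
    ← integral_sub (hint (by fun_prop)) (hint (by fun_prop))]
  refine setIntegral_unitCube_eq_zero_of_fderiv i
    (F := fun t => (((t i : ℂ) ^ (w + k i + 1) - t i) *
      ∏ j ∈ S.erase i, (t j : ℂ) ^ (w + k j)) * ψ t) ?_ ?_ ?_ ?_ (hint (by fun_prop))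
  · have : Continuous fun t : Fin n → ℝ => (t i : ℂ) ^ (w + k i + 1) :=
      (continuous_ofReal_cpow_const (by simpa using add_pos (hre i) one_pos)).comp
        (continuous_apply i)
    fun_prop
  · intro t ht
    exact ((hasFDerivAt_ofReal_cpow_sub i _ (ht i).1).differentiableAt.mul
      (differentiableAt_prod_ofReal_cpow _ _ fun j => (ht j).1)).mul
      (hψ.differentiable one_ne_zero t)
  · intro t ht
    have hu := hasFDerivAt_ofReal_cpow_sub i (w + k i) (ht i).1
    have hm := (differentiableAt_prod_ofReal_cpow (S.erase i) (fun j => w + k j)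
      fun j => (ht j).1).hasFDerivAt
    have h := ((hu.mul hm).mul (hψ.differentiable one_ne_zero t).hasFDerivAt).fderiv
    have hne : (t i : ℂ) ≠ 0 := by exact_mod_cast (ht i).1.ne'
    have e1 : ∏ j ∈ S, (t j : ℂ) ^ (w + k j) =
        (t i : ℂ) ^ (w + k i) * ∏ j ∈ S.erase i, (t j : ℂ) ^ (w + k j) :=
      (Finset.mul_prod_erase S _ hi).symm
    have e2 : ∏ j ∈ S, (t j : ℂ) ^ (w + (Function.update k i (k i + 1) j : ℕ)) =
        (t i : ℂ) ^ (w + k i + 1) * ∏ j ∈ S.erase i, (t j : ℂ) ^ (w + k j) := by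
      rw [← Finset.mul_prod_erase S _ hi]
      congr 1
      · simp [add_assoc]
      · refine Finset.prod_congr rfl fun j hj => ?_
        simp [Finset.ne_of_mem_erase hj]
    refine (DFunLike.congr_fun h _).trans ?_
    rw [e1, e2]
    simp [fderiv_prod_erase_ofReal_cpow_single S (fun j => w + k j) i fun j => (ht j).1]
    ring
  · rintro t (h | h)
    · have : w + k i + 1 ≠ 0 := fun h0 => by
        have := congrArg re h0
        have := hre i
        simp at *
        linarith
      simp [h, this]
    · simp [h]

lemma exists_differentiableOn_eq_prod_mul_cubeMellin {n : ℕ} (N : ℕ) (S : Finset (Fin n))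
    (k : Fin n → ℕ) {ψ : (Fin n → ℝ) → ℂ} (hψ : ContDiff ℝ (⊤ : ℕ∞) ψ) :
    ∃ H : ℂ → ℂ, DifferentiableOn ℂ H {w | -1 - (N : ℝ) < w.re} ∧
      ∀ w : ℂ, 0 < w.re →
        (∏ i ∈ S, ∏ j ∈ Finset.Ico (k i) N, (w + j + 1)) * cubeMellin S k ψ w = H w := by
  induction hM : ∑ i ∈ S, (N - k i) using Nat.strong_induction_on generalizing S k ψ with
  | _ M ih =>
  by_cases hk : ∀ i ∈ S, N ≤ k i
  · refine ⟨cubeMellin S k ψ, differentiableOn_cubeMellin S k N hk hψ.continuous, fun w _ => ?_⟩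
    rw [Finset.prod_eq_one fun i hi => by rw [Finset.Ico_eq_empty_of_le (hk i hi),
      Finset.prod_empty], one_mul]
  push Not at hk
  obtain ⟨i, hi, hki⟩ := hk
  have hψ1 : ContDiff ℝ (⊤ : ℕ∞) fun t => fderiv ℝ ψ t (Pi.single i 1) :=
    (hψ.fderiv_right (by simp)).clm_apply contDiff_const
  have hψ2 : ContDiff ℝ (⊤ : ℕ∞) fun t => ψ t + t i * fderiv ℝ ψ t (Pi.single i 1) :=
    hψ.add ((ofRealCLM.contDiff.comp (contDiff_apply ℝ ℝ i)).mul hψ1)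
  have hsum := Finset.add_sum_erase S (fun i => N - k i) hi
  have hsum' : ∑ j ∈ S, (N - Function.update k i (k i + 1) j) =
      (N - (k i + 1)) + ∑ j ∈ S.erase i, (N - k j) := by
    rw [← Finset.add_sum_erase S _ hi, Function.update_self]
    congr 1
    exact Finset.sum_congr rfl fun j hj => by
      rw [Function.update_of_ne (Finset.ne_of_mem_erase hj)]
  obtain ⟨H₁, hH₁, h₁⟩ := ih _ (by lia) (S.erase i) k hψ2 rfl
  obtain ⟨H₂, hH₂, h₂⟩ := ih _ (by lia) S (Function.update k i (k i + 1)) hψ1 rfl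
  refine ⟨fun w => (∏ j ∈ Finset.Ico (k i + 1) N, (w + j + 1)) * H₁ w - H₂ w, ?_, fun w hw => ?_⟩
  · exact (DifferentiableOn.mul (by fun_prop) hH₁).sub hH₂
  · have e : ∏ l ∈ S, ∏ j ∈ Finset.Ico (Function.update k i (k i + 1) l) N, (w + j + 1) =
        (∏ j ∈ Finset.Ico (k i + 1) N, (w + j + 1)) *
          ∏ l ∈ S.erase i, ∏ j ∈ Finset.Ico (k l) N, (w + j + 1) := by
      rw [← Finset.mul_prod_erase S _ hi, Function.update_self]
      congr 1
      exact Finset.prod_congr rfl fun j hj => by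
        rw [Function.update_of_ne (Finset.ne_of_mem_erase hj)]
    have hrec := cubeMellin_eq_sub S k hi (hψ.of_le (by exact_mod_cast le_top)) hw
    simp only [← h₁ w hw, ← h₂ w hw]
    rw [e, ← Finset.mul_prod_erase S _ hi, Finset.prod_eq_prod_Ico_succ_bot hki]
    linear_combination ((∏ j ∈ Finset.Ico (k i + 1) N, (w + j + 1)) *
          ∏ l ∈ S.erase i, ∏ j ∈ Finset.Ico (k l) N, (w + j + 1)) * hrec

lemma eqOn_re_gt_of_eqOn_re_pos {f g : ℂ → ℂ} {a : ℝ} (hf : DifferentiableOn ℂ f {w | a < w.re})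
    (hg : DifferentiableOn ℂ g {w | a < w.re}) (h : ∀ w : ℂ, 0 < w.re → f w = g w) :
    ∀ w : ℂ, a < w.re → f w = g w := by
  have ho (b : ℝ) : IsOpen {w : ℂ | b < w.re} := isOpen_lt continuous_const continuous_re
  have h0 : ((max a 0 + 1 : ℝ) : ℂ) ∈ {w : ℂ | a < w.re} := by
    simpa using (le_max_left a 0).trans_lt (lt_add_one _)
  refine (hf.analyticOnNhd (ho a)).eqOn_of_preconnected_of_eventuallyEq
    (hg.analyticOnNhd (ho a)) (convex_halfSpace_re_gt a).isPreconnected h0 ?_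
  filter_upwards [(ho 0).mem_nhds (x := ((max a 0 + 1 : ℝ) : ℂ))
    (by simpa using (le_max_right a 0).trans_lt (lt_add_one _))] with w hw
  exact h w hw

lemma eventually_nhdsNE_forall_ne_neg_one_sub (w₀ : ℂ) :
    ∀ᶠ w in nhdsWithin w₀ {w₀}ᶜ, ∀ k : ℕ, w ≠ (-1 - k : ℂ) := by
  obtain ⟨K, hK⟩ := exists_nat_gt (-w₀.re)
  have hfin : ∀ᶠ w in nhdsWithin w₀ {w₀}ᶜ, ∀ k ∈ Finset.range K, w ≠ (-1 - k : ℂ) := by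
    refine (Finset.eventually_all _).2 fun k _ => ?_
    obtain h | h := eq_or_ne w₀ (-1 - k : ℂ)
    · rw [← h]
      exact self_mem_nhdsWithin
    · exact eventually_ne_nhdsWithin h
  have hre : {w : ℂ | -(K : ℝ) < w.re} ∈ nhds w₀ :=
    (isOpen_lt continuous_const continuous_re).mem_nhds (by simpa using neg_lt.1 hK)
  filter_upwards [hfin, mem_nhdsWithin_of_mem_nhds hre] with w hw hw' k hk
  refine hw k (Finset.mem_range.2 ?_) hk
  simp only [hk, sub_re, neg_re, one_re, natCast_re] at hw'
  have : (k : ℝ) < K := by linarith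
  exact_mod_cast this

lemma exists_meromorphic_continuation_of_prod_pow_mul {n : ℕ} {J : ℂ → ℂ} {H : ℕ → ℂ → ℂ}
    (hJ : DifferentiableOn ℂ J {w | -1 < w.re})
    (hH : ∀ N : ℕ, DifferentiableOn ℂ (H N) {w | -1 - (N : ℝ) < w.re})
    (h : ∀ (N : ℕ) (w : ℂ), 0 < w.re → (∏ j ∈ Finset.range N, (w + j + 1)) ^ n * J w = H N w) :
    ∃ g : ℂ → ℂ, (∀ w : ℂ, -1 < w.re → g w = J w) ∧
      (∀ w : ℂ, (∀ k : ℕ, w ≠ -1 - k) → AnalyticAt ℂ g w) ∧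
      ∀ k : ℕ, ∃ f : ℂ → ℂ, AnalyticAt ℂ f (-1 - k) ∧
        ∀ᶠ w in nhdsWithin (-1 - k : ℂ) {(-1 - k : ℂ)}ᶜ, g w = f w / (w - (-1 - k)) ^ n := by
  set P : ℕ → ℂ → ℂ := fun N w => (∏ j ∈ Finset.range N, (w + j + 1)) ^ n with hP
  have hPd (N : ℕ) : Differentiable ℂ (P N) := by fun_prop
  have hP0 (N : ℕ) {w : ℂ} (hw : ∀ k : ℕ, w ≠ -1 - k) : P N w ≠ 0 := by
    refine pow_ne_zero _ (Finset.prod_ne_zero_iff.2 fun j _ h0 => hw j ?_)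
    linear_combination h0
  have hJ' (N : ℕ) (w : ℂ) (hw : -1 < w.re) : P N w * J w = H N w := by
    refine eqOn_re_gt_of_eqOn_re_pos ((hPd N).differentiableOn.mul hJ)
      ((hH N).mono fun z hz => ?_) (h N) w hw
    have hz' : -1 < z.re := hz
    show -1 - (N : ℝ) < z.re
    linarith [N.cast_nonneg (α := ℝ)]
  have hPH (N M : ℕ) (w : ℂ) (hN : -1 - (N : ℝ) < w.re) (hM : -1 - (M : ℝ) < w.re) :
      P M w * H N w = P N w * H M w := by
    refine eqOn_re_gt_of_eqOn_re_pos (a := max (-1 - (N : ℝ)) (-1 - (M : ℝ)))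
      ((hPd M).differentiableOn.mul ((hH N).mono fun z (hz : _ < z.re) => (max_lt_iff.1 hz).1))
      ((hPd N).differentiableOn.mul ((hH M).mono fun z (hz : _ < z.re) => (max_lt_iff.1 hz).2))
      (fun z hz => ?_) w (max_lt hN hM)
    simp only [Pi.mul_apply, ← h N z hz, ← h M z hz, hP]
    ring
  have hceil (w : ℂ) : -1 - (⌈-w.re⌉₊ : ℝ) < w.re := by linarith [Nat.le_ceil (-w.re)]
  set g : ℂ → ℂ := fun w => H ⌈-w.re⌉₊ w / P ⌈-w.re⌉₊ w with hg
  have hgN (N : ℕ) (w : ℂ) (hN : -1 - (N : ℝ) < w.re) (hw : ∀ k : ℕ, w ≠ -1 - k) :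
      g w = H N w / P N w := by
    rw [hg, div_eq_div_iff (hP0 _ hw) (hP0 _ hw), mul_comm, hPH _ N w (hceil w) hN, mul_comm]
  have hgt (N : ℕ) {w : ℂ} (hw : -1 - (N : ℝ) < w.re) : {w : ℂ | -1 - (N : ℝ) < w.re} ∈ nhds w :=
    (isOpen_lt continuous_const continuous_re).mem_nhds hw
  refine ⟨g, fun w hw => ?_, fun w hw => ?_, fun k => ?_⟩
  · have hw' : ∀ k : ℕ, w ≠ -1 - k := by
      rintro k rfl
      simp at hw
      linarith [k.cast_nonneg (α := ℝ)]
    rw [hgN 0 w (by simpa using hw) hw', ← hJ' 0 w hw]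
    simp [hP]
  · have ha : AnalyticAt ℂ (fun z => H ⌈-w.re⌉₊ z / P ⌈-w.re⌉₊ z) w :=
      ((hH _).analyticAt (hgt _ (hceil w))).div ((hPd _).analyticAt w) (hP0 _ hw)
    refine ha.congr ?_
    have hne := eventually_nhdsNE_forall_ne_neg_one_sub w
    rw [eventually_nhdsWithin_iff] at hne
    filter_upwards [hne, hgt _ (hceil w)] with z hz hz'
    refine (hgN _ z hz' ?_).symm
    obtain rfl | hzw := eq_or_ne z w
    exacts [hw, hz hzw]
  · set w₀ : ℂ := -1 - k with hw₀
    have hk : -1 - ((k + 1 : ℕ) : ℝ) < w₀.re := by simp [hw₀]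
    refine ⟨fun w => H (k + 1) w / (∏ j ∈ Finset.range k, (w + j + 1)) ^ n,
      ((hH (k + 1)).analyticAt (hgt _ hk)).div (Differentiable.analyticAt (by fun_prop) _)
        (pow_ne_zero _ (Finset.prod_ne_zero_iff.2 fun j hj h0 => ?_)), ?_⟩
    · have : (j : ℂ) = k := by rw [hw₀] at h0; linear_combination h0
      exact (Finset.mem_range.1 hj).ne (by exact_mod_cast this)
    · filter_upwards [eventually_nhdsNE_forall_ne_neg_one_sub w₀,
        mem_nhdsWithin_of_mem_nhds (hgt _ hk)] with w hw hw'
      rw [hgN _ w hw' hw, hP]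
      simp only [Finset.prod_range_succ, mul_pow, div_div]
      rw [hw₀, show w - (-1 - k) = w + k + 1 by ring]

lemma ofReal_prod_cpow {ι : Type*} (S : Finset ι) (t : ι → ℝ) (ht : ∀ i, 0 ≤ t i) (z : ℂ) :
    (∏ i ∈ S, (t i : ℂ)) ^ z = ∏ i ∈ S, (t i : ℂ) ^ z := by
  classical
  induction S using Finset.induction_on with
  | empty => simp
  | insert i S hi ih =>
    rw [Finset.prod_insert hi, Finset.prod_insert hi, ← ih, ← ofReal_prod,
      mul_cpow_ofReal_nonneg (ht i) (Finset.prod_nonneg fun j _ => ht j)]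

lemma prod_cpow_mul_inv_pow_mul_eq {ι : Type*} [Fintype ι] [DecidableEq ι] (l : ι) (m : ℕ)
    (s x : ℂ) {t : ι → ℝ} (ht : ∀ i, 0 < t i) :
    (∏ i, (t i : ℂ)) ^ (2 * s - 2) * ((t l : ℂ) ^ m)⁻¹ * x =
      (∏ i, (t i : ℂ) ^ (2 * s - 2 - m)) * ((∏ i ∈ Finset.univ.erase l, (t i : ℂ) ^ m) * x) := by
  have hne (i : ι) : (t i : ℂ) ≠ 0 := by exact_mod_cast (ht i).ne'
  have h : (∏ i, (t i : ℂ)) ^ (2 * s - 2) =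
      (∏ i, (t i : ℂ) ^ (2 * s - 2 - m)) * ∏ i, (t i : ℂ) ^ m := by
    rw [ofReal_prod_cpow _ _ (fun i => (ht i).le), ← Finset.prod_mul_distrib]
    refine Finset.prod_congr rfl fun i _ => ?_
    rw [← cpow_natCast, ← cpow_add _ _ (hne i), sub_add_cancel]
  rw [h, ← Finset.mul_prod_erase _ (fun i => (t i : ℂ) ^ m) (Finset.mem_univ l)]
  field_simp [hne l]

/-- Mellin-transform form of the pushforward lemma (Jeanquartier, Melrose) for
`F(t) = t₁² ⋯ tₙ²` on the cube: for smooth `φ`, the integral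
`I(s) = ∫_{[0,1]^n} (t₁⋯tₙ)^{2s-2} tₙ^{-m} φ(t) dt` converges and is holomorphic for
`Re s > (m+1)/2`, and extends meromorphically to `ℂ`, analytic off
`{(1 + m - k)/2 : k ∈ ℕ}`, with poles of order at most `n` at each such point. -/
theorem mellin_pushforward_meromorphic_continuation
    (n : ℕ) (hn : 1 ≤ n) (m : ℕ)
    (φ : (Fin n → ℝ) → ℂ) (hφ : ContDiff ℝ (⊤ : ℕ∞) φ) :
    (∀ s : ℂ, ((m : ℝ) + 1) / 2 < s.re →
      IntegrableOn
        (fun t : Fin n → ℝ =>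
          (∏ i, (t i : ℂ)) ^ (2 * s - 2) *
            ((t ⟨n - 1, Nat.sub_lt hn Nat.one_pos⟩ : ℂ) ^ m)⁻¹ * φ t)
        (Set.univ.pi fun _ => Set.Icc (0 : ℝ) 1)) ∧
    (∀ s : ℂ, ((m : ℝ) + 1) / 2 < s.re →
      AnalyticAt ℂ
        (fun s : ℂ => ∫ t in Set.univ.pi fun _ : Fin n => Set.Icc (0 : ℝ) 1,
          (∏ i, (t i : ℂ)) ^ (2 * s - 2) *
            ((t ⟨n - 1, Nat.sub_lt hn Nat.one_pos⟩ : ℂ) ^ m)⁻¹ * φ t) s) ∧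
    ∃ g : ℂ → ℂ,
      MeromorphicOn g Set.univ ∧
      (∀ s : ℂ, ((m : ℝ) + 1) / 2 < s.re →
        g s = ∫ t in Set.univ.pi fun _ : Fin n => Set.Icc (0 : ℝ) 1,
          (∏ i, (t i : ℂ)) ^ (2 * s - 2) *
            ((t ⟨n - 1, Nat.sub_lt hn Nat.one_pos⟩ : ℂ) ^ m)⁻¹ * φ t) ∧
      (∀ s : ℂ, (∀ k : ℕ, s ≠ ((1 : ℂ) + m - k) / 2) → AnalyticAt ℂ g s) ∧
      ∀ k : ℕ, ∃ h : ℂ → ℂ,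
        AnalyticAt ℂ h (((1 : ℂ) + m - k) / 2) ∧
        ∀ᶠ s in nhdsWithin (((1 : ℂ) + m - k) / 2) {(((1 : ℂ) + m - k) / 2)}ᶜ,
          g s = h s / (s - ((1 : ℂ) + m - k) / 2) ^ n := by
  set l : Fin n := ⟨n - 1, Nat.sub_lt hn Nat.one_pos⟩
  set Q : Set (Fin n → ℝ) := Set.univ.pi fun _ => Set.Icc (0 : ℝ) 1
  set ψ : (Fin n → ℝ) → ℂ := fun t => (∏ i ∈ Finset.univ.erase l, (t i : ℂ) ^ m) * φ t
  set J : ℂ → ℂ := cubeMellin Finset.univ 0 ψ with hJ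
  have hψ : ContDiff ℝ (⊤ : ℕ∞) ψ := by
    refine ContDiff.mul (contDiff_prod fun i _ => ?_) hφ
    exact (ofRealCLM.contDiff.comp (contDiff_apply ℝ ℝ i)).pow m
  have hae (s : ℂ) : (fun t : Fin n → ℝ => (∏ i, (t i : ℂ)) ^ (2 * s - 2) *
      ((t l : ℂ) ^ m)⁻¹ * φ t) =ᵐ[volume.restrict Q]
      fun t => (∏ i, (t i : ℂ) ^ (2 * s - 2 - m)) * ψ t := by
    filter_upwards [ae_restrict_unitCube_mem_Ioo] with t ht
    exact prod_cpow_mul_inv_pow_mul_eq l m s (φ t) fun i => (ht i).1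
  have hI (s : ℂ) : ∫ t in Q, (∏ i, (t i : ℂ)) ^ (2 * s - 2) * ((t l : ℂ) ^ m)⁻¹ * φ t =
      J (2 * s - 2 - m) := by
    rw [integral_congr_ae (hae s), hJ, cubeMellin]
    simp [Q]
  have hre {s : ℂ} (hs : ((m : ℝ) + 1) / 2 < s.re) : -1 < (2 * s - 2 - m).re := by
    simp
    linarith
  have hJd : DifferentiableOn ℂ J {w | -1 < w.re} := by
    simpa using differentiableOn_cubeMellin Finset.univ 0 0 (by simp) hψ.continuous
  choose H hH hJH using fun N =>
    exists_differentiableOn_eq_prod_mul_cubeMellin N Finset.univ 0 hψ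
  obtain ⟨g, hgJ, hga, hgp⟩ := exists_meromorphic_continuation_of_prod_pow_mul (n := n) hJd hH
    fun N w hw => by simpa using hJH N w hw
  have hpole (k : ℕ) : ∃ h : ℂ → ℂ, AnalyticAt ℂ h (((1 : ℂ) + m - k) / 2) ∧
      ∀ᶠ s in nhdsWithin (((1 : ℂ) + m - k) / 2) {(((1 : ℂ) + m - k) / 2)}ᶜ,
        g (2 * s - 2 - m) = h s / (s - ((1 : ℂ) + m - k) / 2) ^ n := by
    obtain ⟨f, hf, hfg⟩ := hgp k
    set s₀ : ℂ := ((1 : ℂ) + m - k) / 2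
    have hs₀ : 2 * s₀ - 2 - m = -1 - k := by simp only [s₀]; ring
    refine ⟨fun s => f (2 * s - 2 - m) / 2 ^ n, ?_, ?_⟩
    · refine AnalyticAt.div_const (AnalyticAt.fun_comp (g := f) ?_ (by fun_prop))
      rwa [hs₀]
    · have ht : Tendsto (fun s : ℂ => 2 * s - 2 - m) (nhdsWithin s₀ {s₀}ᶜ)
          (nhdsWithin (-1 - k : ℂ) {(-1 - k : ℂ)}ᶜ) := by
        refine tendsto_nhdsWithin_iff.2 ⟨?_, ?_⟩
        · rw [← hs₀]
          exact (Continuous.tendsto (by fun_prop) s₀).mono_left nhdsWithin_le_nhds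
        · filter_upwards [self_mem_nhdsWithin] with s hs h
          refine hs ?_
          rw [Set.mem_singleton_iff, ← hs₀] at h
          simpa using h
      filter_upwards [ht.eventually hfg] with s hs
      rw [hs, div_div, ← mul_pow, ← hs₀]
      congr 2
      ring
  have han (s : ℂ) (hs : ∀ k : ℕ, s ≠ ((1 : ℂ) + m - k) / 2) :
      AnalyticAt ℂ (fun s => g (2 * s - 2 - m)) s := by
    refine AnalyticAt.fun_comp (g := g) (hga _ fun k hk => hs k ?_) (by fun_prop)
    linear_combination hk / 2
  refine ⟨fun s hs => ?_, fun s hs => ?_, fun s => g (2 * s - 2 - m), fun s _ => ?_,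
    fun s hs => ?_, han, hpole⟩
  · refine Integrable.congr ?_ (hae s).symm
    exact integrableOn_unitCube_prod_cpow_mul Finset.univ (fun _ => 2 * s - 2 - m)
      (fun _ _ => hre hs) hψ.continuous
  · simp_rw [hI]
    refine AnalyticAt.fun_comp (g := J) (hJd.analyticAt ?_) (by fun_prop)
    exact (isOpen_lt continuous_const continuous_re).mem_nhds (hre hs)
  · by_cases h : ∀ k : ℕ, s ≠ ((1 : ℂ) + m - k) / 2
    · exact (han s h).meromorphicAt
    · push Not at h
      obtain ⟨k, rfl⟩ := h
      obtain ⟨f, hf, hfg⟩ := hpole k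
      refine MeromorphicAt.congr (f := fun s => f s / (s - ((1 : ℂ) + m - k) / 2) ^ n) ?_
        (hfg.mono fun _ h => h.symm)
      exact hf.meromorphicAt.div (AnalyticAt.meromorphicAt (by fun_prop))
  · rw [hI]
    exact hgJ _ (hre hs)
end

section
/- Let E be a complex Banach space and K : E → E a compact continuous linear operator. Then the set S = {z ∈ ℂ : Id + z·K is not invertible (as a continuous linear operator with continuous inverse)} is closed in ℂ and discrete: every point z₀ ∈ S has a punctured neighborhood containing no other point of S. In particular S has no accumulation point in ℂ, and the set of z for which Id + z·K is invertible is open, connected and dense in ℂ. -/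
open Filter

namespace IsCompactOperator

open Module End Set

variable {𝕜 X : Type*} [NontriviallyNormedField 𝕜] [NormedAddCommGroup X] [NormedSpace 𝕜 X]
  {T : X →L[𝕜] X}

/-- A compact operator cannot map a bounded sequence to a uniformly separated one. -/
theorem not_forall_lt_one_le_norm_sub (hT : IsCompactOperator T) {w : ℕ → X} {r : ℝ}
    (hw : ∀ n, ‖w n‖ ≤ r) : ¬ ∀ m n, m < n → 1 ≤ ‖T (w n) - T (w m)‖ := by
  intro hsep
  obtain ⟨C, hC, hC'⟩ := hT.image_closedBall_subset_compact r
  obtain ⟨y, -, ψ, hψ, hψy⟩ :=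
    hC.tendsto_subseq (x := fun n ↦ T (w n)) (fun n ↦ hC' ⟨w n, by simp [hw], rfl⟩)
  obtain ⟨N, hN⟩ := Metric.cauchySeq_iff'.1 hψy.cauchySeq 1 one_pos
  have h := hN (N + 1) N.le_succ
  rw [dist_eq_norm] at h
  exact h.not_ge (hsep _ _ (hψ N.lt_succ_self))

/-- A compact operator has only finitely many eigenvalues outside any disc around `0`. -/
theorem finite_hasEigenvalue_of_le_norm [CompleteSpace 𝕜] (hT : IsCompactOperator T)
    {ε : ℝ} (hε : 0 < ε) : {μ : 𝕜 | HasEigenvalue (T : End 𝕜 X) μ ∧ ε ≤ ‖μ‖}.Finite := by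
  by_contra hinf
  have : Infinite {μ : 𝕜 | HasEigenvalue (T : End 𝕜 X) μ ∧ ε ≤ ‖μ‖} :=
    Set.infinite_coe_iff.2 hinf
  let e := Infinite.natEmbedding {μ : 𝕜 | HasEigenvalue (T : End 𝕜 X) μ ∧ ε ≤ ‖μ‖}
  let μ (n : ℕ) : 𝕜 := e n
  have hμε (n : ℕ) : ε ≤ ‖μ n‖ := (e n).2.2
  have hμ0 (n : ℕ) : μ n ≠ 0 := norm_pos_iff.1 (hε.trans_le (hμε n))
  choose x hx using fun n ↦ (e n).2.1.exists_hasEigenvector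
  have hli : LinearIndependent 𝕜 x :=
    eigenvectors_linearIndependent' (T : End 𝕜 X) μ
      (Subtype.val_injective.comp e.injective) x hx
  have hTx (n : ℕ) : T (x n) = μ n • x n := (hx n).apply_eq_smul
  let V (n : ℕ) : Submodule 𝕜 X := Submodule.span 𝕜 (x '' Iio n)
  have hV_mono : Monotone V := fun m n h ↦
    Submodule.span_mono (image_mono (Iio_subset_Iio h))
  have hxV {m n : ℕ} (h : m < n) : x m ∈ V n := Submodule.subset_span ⟨m, h, rfl⟩
  have hV_closed (n : ℕ) : IsClosed (V n : Set X) := by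
    have : FiniteDimensional 𝕜 (V n) :=
      FiniteDimensional.span_of_finite 𝕜 ((finite_Iio n).image x)
    exact (V n).closed_of_finiteDimensional
  have hTV (n : ℕ) {v : X} (hv : v ∈ V n) : T v ∈ V n := by
    have : V n ≤ (V n).comap (T : X →ₗ[𝕜] X) := by
      refine Submodule.span_le.2 ?_
      rintro _ ⟨i, hi, rfl⟩
      simpa [hTx] using (V n).smul_mem (μ i) (hxV hi)
    exact this hv
  have hTV_sub (n : ℕ) {v : X} (hv : v ∈ V (n + 1)) : T v - μ n • v ∈ V n := by
    have : V (n + 1) ≤ (V n).comap ((T - μ n • 1 : X →L[𝕜] X) : X →ₗ[𝕜] X) := by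
      refine Submodule.span_le.2 ?_
      rintro _ ⟨i, hi, rfl⟩
      rcases (Nat.lt_succ_iff.1 hi).eq_or_lt with rfl | hi
      · simp [hTx]
      · simpa [hTx] using
          (V n).sub_mem ((V n).smul_mem (μ i) (hxV hi)) ((V n).smul_mem (μ n) (hxV hi))
    simpa using this hv
  obtain ⟨c, hc⟩ := NormedField.exists_one_lt_norm 𝕜
  have riesz (n : ℕ) : ∃ u ∈ V (n + 1), ‖u‖ ≤ ‖c‖ + 1 ∧ ∀ y ∈ V n, 1 ≤ ‖u - y‖ := by
    have h₁ : IsClosed ((V n).comap (V (n + 1)).subtype : Set (V (n + 1))) :=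
      (hV_closed n).preimage continuous_subtype_val
    have h₂ : ∃ v : V (n + 1), v ∉ (V n).comap (V (n + 1)).subtype :=
      ⟨⟨x n, hxV n.lt_succ_self⟩, hli.notMem_span_image (by simp)⟩
    obtain ⟨⟨u, hu⟩, hun, huy⟩ := riesz_lemma_of_norm_lt hc (lt_add_one ‖c‖) h₁ h₂
    exact ⟨u, hu, hun, fun y hy ↦ huy ⟨y, hV_mono n.le_succ hy⟩ hy⟩
  choose u huV hun huy using riesz
  have hTw (n : ℕ) : T ((μ n)⁻¹ • u n) - u n ∈ V n := by
    have h := (V n).smul_mem (μ n)⁻¹ (hTV_sub n (huV n))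
    rwa [smul_sub, inv_smul_smul₀ (hμ0 n), ← map_smul] at h
  refine hT.not_forall_lt_one_le_norm_sub (w := fun n ↦ (μ n)⁻¹ • u n)
    (r := ε⁻¹ * (‖c‖ + 1)) (fun n ↦ ?_) fun m n hmn ↦ ?_
  · rw [norm_smul, norm_inv]
    gcongr
    exacts [hμε n, hun n]
  · have hm : T ((μ m)⁻¹ • u m) ∈ V n :=
      hTV n ((V n).smul_mem _ (hV_mono hmn (huV m)))
    convert huy n _ ((V n).sub_mem hm (hTw n)) using 2
    abel

variable [CompleteSpace X]

/-- If `1 + z • T` is not invertible for a compact operator `T`, then `-z⁻¹` is an eigenvalue. -/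
theorem hasEigenvalue_of_not_isUnit_one_add_smul (hT : IsCompactOperator T) {z : 𝕜}
    (hz : ¬ IsUnit (1 + z • T)) : z ≠ 0 ∧ HasEigenvalue (T : End 𝕜 X) (-z⁻¹) := by
  have hz0 : z ≠ 0 := by
    rintro rfl
    simp at hz
  refine ⟨hz0, (hT.hasEigenvalue_or_mem_resolventSet (by simpa using hz0)).resolve_right ?_⟩
  contrapose! hz
  rw [spectrum.mem_resolventSet_iff] at hz
  have h : (1 : X →L[𝕜] X) + z • T
      = Units.mk0 (-z) (neg_ne_zero.2 hz0) • (algebraMap 𝕜 (X →L[𝕜] X) (-z⁻¹) - T) := by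
    rw [Units.smul_mk0, Algebra.algebraMap_eq_smul_one, smul_sub, smul_smul]
    simp [hz0]
  rw [h]
  exact hz.smul _

theorem finite_not_isUnit_one_add_smul_inter_closedBall [CompleteSpace 𝕜]
    (hT : IsCompactOperator T) {r : ℝ} (hr : 0 < r) :
    ({z : 𝕜 | ¬ IsUnit (1 + z • T)} ∩ Metric.closedBall 0 r).Finite := by
  refine Finite.of_finite_image (f := fun z ↦ -z⁻¹)
    ((hT.finite_hasEigenvalue_of_le_norm (inv_pos.2 hr)).subset ?_)
    (fun a _ b _ h ↦ inv_injective (neg_injective h))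
  rintro _ ⟨z, ⟨hz, hzr⟩, rfl⟩
  obtain ⟨hz0, hev⟩ := hT.hasEigenvalue_of_not_isUnit_one_add_smul hz
  refine ⟨hev, ?_⟩
  rw [norm_neg, norm_inv]
  exact inv_anti₀ (norm_pos_iff.2 hz0) (by simpa using hzr)

theorem not_accPt_not_isUnit_one_add_smul [CompleteSpace 𝕜] (hT : IsCompactOperator T) (z₀ : 𝕜) :
    ¬ AccPt z₀ (𝓟 {z : 𝕜 | ¬ IsUnit (1 + z • T)}) := by
  intro h
  have hU : Metric.closedBall (0 : 𝕜) (‖z₀‖ + 1) ∈ nhds z₀ :=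
    mem_of_superset (Metric.isOpen_ball.mem_nhds (by simp)) Metric.ball_subset_closedBall
  refine Infinite.of_accPt (h.nhds_inter hU) ?_
  rw [inter_comm]
  exact hT.finite_not_isUnit_one_add_smul_inter_closedBall (by positivity)

theorem countable_not_isUnit_one_add_smul [CompleteSpace 𝕜] (hT : IsCompactOperator T) :
    {z : 𝕜 | ¬ IsUnit (1 + z • T)}.Countable := by
  refine (countable_iUnion fun n : ℕ ↦
    (hT.finite_not_isUnit_one_add_smul_inter_closedBall n.cast_add_one_pos).countable).mono
    fun z hz ↦ ?_
  obtain ⟨n, hn⟩ := exists_nat_ge ‖z‖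
  exact mem_iUnion.2 ⟨n, hz, by simpa using hn.trans (lt_add_one _).le⟩

theorem isOpen_isUnit_one_add_smul (T : X →L[𝕜] X) : IsOpen {z : 𝕜 | IsUnit (1 + z • T)} :=
  Units.isOpen.preimage (by fun_prop : Continuous fun z : 𝕜 ↦ 1 + z • T)

end IsCompactOperator

/-- One-parameter analytic Fredholm alternative: for a compact operator `K` on a complex
Banach space, the set `S` of `z ∈ ℂ` for which `Id + z • K` is not invertible is closed and
discrete (each of its points has a punctured neighborhood free of `S`); in particular `S` has
no accumulation point, and the complementary set of invertible parameters is open, connected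
and dense in `ℂ`. -/
theorem compact_operator_noninvertible_set_discrete
    (E : Type*) [NormedAddCommGroup E] [NormedSpace ℂ E] [CompleteSpace E]
    (K : E →L[ℂ] E) (hK : IsCompactOperator (⇑K)) :
    IsClosed {z : ℂ | ¬ IsUnit ((1 : E →L[ℂ] E) + z • K)} ∧
    (∀ z₀ ∈ {z : ℂ | ¬ IsUnit ((1 : E →L[ℂ] E) + z • K)},
      ∃ U ∈ nhds z₀, U ∩ {z : ℂ | ¬ IsUnit ((1 : E →L[ℂ] E) + z • K)} ⊆ {z₀}) ∧
    (∀ z₀ : ℂ, ¬ AccPt z₀ (Filter.principal {z : ℂ | ¬ IsUnit ((1 : E →L[ℂ] E) + z • K)})) ∧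
    IsOpen {z : ℂ | IsUnit ((1 : E →L[ℂ] E) + z • K)} ∧
    IsConnected {z : ℂ | IsUnit ((1 : E →L[ℂ] E) + z • K)} ∧
    Dense {z : ℂ | IsUnit ((1 : E →L[ℂ] E) + z • K)} := by
  have hacc := hK.not_accPt_not_isUnit_one_add_smul
  have hcount := hK.countable_not_isUnit_one_add_smul
  have hopen := IsCompactOperator.isOpen_isUnit_one_add_smul K
  have hcompl : {z : ℂ | ¬ IsUnit ((1 : E →L[ℂ] E) + z • K)}ᶜ
      = {z : ℂ | IsUnit ((1 : E →L[ℂ] E) + z • K)} := by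
    ext z
    simp
  refine ⟨isOpen_compl_iff.1 (hcompl ▸ hopen), fun z₀ _ ↦ ?_, hacc, hopen, ?_, ?_⟩
  · have h := hacc z₀
    rw [accPt_iff_nhds] at h
    push Not at h
    obtain ⟨U, hU, h⟩ := h
    exact ⟨U, hU, fun z hz ↦ h z hz⟩
  · rw [← hcompl]
    exact (hcount.isPathConnected_compl_of_one_lt_rank (by simp)).isConnected
  · rw [← hcompl]
    exact hcount.dense_compl ℂ
end
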